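/- arXiv:1210.2905 — 9 statements merged into one kernel-verified Lean document; each statement's English description precedes it below -/
import Mathlib

section
/- For every integer m ≥ 2, the 2-dimensional Lebesgue measure of the region R₋(m) = ⋃_{i=1}^{m} [0,2i] × [0, 2m+1−2i] ⊆ ℝ² equals 2m². -/
open MeasureTheory Set ENNReal

/-- The region `R₋(m) = ⋃_{i=1}^{m} [0, 2i] × [0, 2m+1−2i] ⊆ ℝ²`
(the region of the plane curve `P(−m)` for `m ≥ 2`). -/
def Rneg (m : ℕ) : Set (ℝ × ℝ) :=
  ⋃ i ∈ Finset.Icc 1 m,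
    Set.Icc (0 : ℝ) (2 * (i : ℝ)) ×ˢ Set.Icc (0 : ℝ) (2 * (m : ℝ) + 1 - 2 * (i : ℝ))

/-- The union of the rectangles `[0, 2i] × [0, c - 2i]` for `1 ≤ i ≤ n`. -/
def staircase (c : ℝ) (n : ℕ) : Set (ℝ × ℝ) :=
  ⋃ i ∈ Finset.Icc 1 n, Set.Icc (0 : ℝ) (2 * (i : ℝ)) ×ˢ Set.Icc (0 : ℝ) (c - 2 * (i : ℝ))

theorem staircase_succ (c : ℝ) {n : ℕ} (hn : 1 ≤ n) :
    staircase c (n + 1) = staircase c n ∪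
      Set.Ioc (2 * (n : ℝ)) (2 * (n : ℝ) + 2) ×ˢ Set.Icc (0 : ℝ) (c - 2 * (n : ℝ) - 2) := by
  ext ⟨x, y⟩
  simp only [staircase, Set.mem_iUnion, Set.mem_union, Set.mem_prod, Set.mem_Icc, Set.mem_Ioc,
    Finset.mem_Icc, exists_prop]
  constructor
  · rintro ⟨i, ⟨hi, hin⟩, ⟨hx, hxi⟩, hy, hyi⟩
    rcases Nat.le_succ_iff.mp hin with hin | rfl
    · exact Or.inl ⟨i, ⟨hi, hin⟩, ⟨hx, hxi⟩, hy, hyi⟩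
    · push_cast at hxi hyi
      rcases le_or_gt x (2 * n) with h | h
      · exact Or.inl ⟨n, ⟨hn, le_rfl⟩, ⟨hx, h⟩, hy, by linarith⟩
      · exact Or.inr ⟨⟨h, by linarith⟩, hy, by linarith⟩
  · rintro (⟨i, ⟨hi, hin⟩, h⟩ | ⟨⟨hx, hxn⟩, hy, hyn⟩)
    · exact ⟨i, ⟨hi, by lia⟩, h⟩
    · have : (0 : ℝ) ≤ n := n.cast_nonneg
      refine ⟨n + 1, ⟨by lia, le_rfl⟩, ⟨by linarith, ?_⟩, hy, ?_⟩ <;> push_cast <;> linarith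

theorem disjoint_staircase (c : ℝ) (n : ℕ) (b : ℝ) (t : Set ℝ) :
    Disjoint (staircase c n) (Set.Ioc (2 * (n : ℝ)) b ×ˢ t) := by
  rw [Set.disjoint_left]
  rintro ⟨x, y⟩ h ⟨⟨hx, -⟩, -⟩
  simp only [staircase, Set.mem_iUnion, Set.mem_prod, Set.mem_Icc, Finset.mem_Icc,
    exists_prop] at h
  obtain ⟨i, ⟨-, hin⟩, ⟨-, hxi⟩, -⟩ := h
  have : (i : ℝ) ≤ n := by exact_mod_cast hin
  dsimp only at hx
  linarith

theorem volume_staircase (c : ℝ) {n : ℕ} (hn : 1 ≤ n) (hc : 2 * (n : ℝ) ≤ c) :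
    volume (staircase c n) = ENNReal.ofReal (2 * n * (c - n - 1)) := by
  induction n, hn using Nat.le_induction with
  | base =>
    simp only [staircase, Finset.Icc_self, Finset.mem_singleton, Set.iUnion_iUnion_eq_left,
      Measure.volume_eq_prod, Measure.prod_prod, Real.volume_Icc]
    rw [← ENNReal.ofReal_mul (by norm_num)]
    congr 1
    push_cast
    ring
  | succ n hn ih =>
    push_cast at hc
    have hn' : (1 : ℝ) ≤ n := by exact_mod_cast hn
    rw [staircase_succ c hn, measure_union (disjoint_staircase c n _ _)
      (measurableSet_Ioc.prod measurableSet_Icc), ih (by linarith), Measure.volume_eq_prod,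
      Measure.prod_prod, Real.volume_Ioc, Real.volume_Icc, ← ENNReal.ofReal_mul (by linarith),
      ← ENNReal.ofReal_add (mul_nonneg (by linarith) (by linarith))
        (mul_nonneg (by linarith) (by linarith))]
    congr 1
    push_cast
    ring

/-- For every integer `m ≥ 2`, the area of `R₋(m)` equals `2m²`. -/
theorem stmt_1 (m : ℕ) (hm : 2 ≤ m) :
    volume (Rneg m) = ((2 * m ^ 2 : ℕ) : ℝ≥0∞) := by
  have h := volume_staircase (2 * (m : ℝ) + 1) (n := m) (by lia) (by linarith)
  rw [← ENNReal.ofReal_natCast]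
  refine h.trans ?_
  congr 1
  push_cast
  ring
end

section
/- For every integer j ≥ 1, the 2-dimensional Lebesgue measure of the region R(j) = ⋃_{i=1}^{j+1} [0, a_i^{(j)}] × [0, b_i^{(j)}] ⊆ ℝ² equals 2j² + 2j, where the sequence (a_i^{(j)}, b_i^{(j)}) is defined by the recursion [(a_i,b_i)^{(1)}] = [(1,3),(2,1)], and for j ≥ 2: (a_1,b_1)^{(j)} = (1, 2j+1) and (a_i,b_i)^{(j)} = (b_{j+2−i}^{(j−1)} + 1, a_{j+2−i}^{(j−1)} + 1) for 2 ≤ i ≤ j+1. -/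
open MeasureTheory Set ENNReal

/-- The recursively defined sequence of lattice points `(a_i^{(j)}, b_i^{(j)})`
(`ab j i` is `(a_i^{(j)}, b_i^{(j)})` for `1 ≤ i ≤ j+1`):
`[(a_i,b_i)^{(1)}] = [(1,3),(2,1)]`, and for `j ≥ 2`,
`(a_1,b_1)^{(j)} = (1, 2j+1)` and
`(a_i,b_i)^{(j)} = (b_{j+2−i}^{(j−1)} + 1, a_{j+2−i}^{(j−1)} + 1)` for `2 ≤ i ≤ j+1`. -/
def ab : ℕ → ℕ → ℤ × ℤ
  | 0, _ => (0, 0)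
  | 1, i => if i = 1 then (1, 3) else if i = 2 then (2, 1) else (0, 0)
  | (j + 2), i =>
      if i = 1 then (1, 2 * (j + 2) + 1)
      else ((ab (j + 1) ((j + 2) + 2 - i)).2 + 1, (ab (j + 1) ((j + 2) + 2 - i)).1 + 1)

/-- The region `R(j) = ⋃_{i=1}^{j+1} [0, a_i^{(j)}] × [0, b_i^{(j)}] ⊆ ℝ²`. -/
def Rreg (j : ℕ) : Set (ℝ × ℝ) :=
  ⋃ i ∈ Finset.Icc 1 (j + 1),
    Set.Icc (0 : ℝ) ((ab j i).1 : ℝ) ×ˢ Set.Icc (0 : ℝ) ((ab j i).2 : ℝ)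

theorem ab_succ_one (j : ℕ) : ab (j + 1) 1 = (1, 2 * (j : ℤ) + 3) := by
  cases j with
  | zero => simp [ab]
  | succ j => simp [ab]; ring

theorem ab_succ_succ (j i : ℕ) (hi : 2 ≤ i) :
    ab (j + 2) i = ((ab (j + 1) (j + 4 - i)).2 + 1, (ab (j + 1) (j + 4 - i)).1 + 1) := by
  simp [ab, show i ≠ 1 by omega]

theorem ab_fst_le_snd_le (j i : ℕ) (h1 : 1 ≤ i) (h2 : i ≤ j + 2) :
    (ab (j + 1) i).1 ≤ 2 * j + 2 ∧ (ab (j + 1) i).2 ≤ 2 * j + 3 := by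
  induction j generalizing i with
  | zero =>
    interval_cases i <;> simp [ab]
  | succ j ih =>
    rcases h1.eq_or_lt with rfl | h1
    · rw [ab_succ_one]
      push_cast
      constructor <;> omega
    · rw [ab_succ_succ j i h1]
      obtain ⟨ha, hb⟩ := ih (j + 4 - i) (by omega) (by omega)
      push_cast
      constructor <;> omega

/-- The variant of `Rreg` built from the half-open rectangles `(0, a_i] × (0, b_i]`. -/
def RregIoc (j : ℕ) : Set (ℝ × ℝ) :=
  ⋃ i ∈ Finset.Icc 1 (j + 1),
    Set.Ioc (0 : ℝ) ((ab j i).1 : ℝ) ×ˢ Set.Ioc (0 : ℝ) ((ab j i).2 : ℝ)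

theorem measurableSet_RregIoc (j : ℕ) : MeasurableSet (RregIoc j) :=
  Finset.measurableSet_biUnion _ fun _ _ => measurableSet_Ioc.prod measurableSet_Ioc

theorem volume_Rreg_eq_volume_RregIoc (j : ℕ) : volume (Rreg j) = volume (RregIoc j) := by
  apply measure_congr
  refine Filter.EventuallyEq.countable_bUnion (Finset.countable_toSet (Finset.Icc 1 (j + 1)))
    fun i _ => ?_
  exact Measure.set_prod_ae_eq Ioc_ae_eq_Icc.symm Ioc_ae_eq_Icc.symm

/-- Reflection in the diagonal composed with a translation, carrying the part of `R(j + 1)`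
above and to the right of `(1, 1)` onto `R(j)`. -/
def swapSub (p : ℝ × ℝ) : ℝ × ℝ := p.swap - (1, 1)

theorem measurePreserving_swapSub : MeasurePreserving swapSub volume volume :=
  (measurePreserving_sub_right (volume : Measure (ℝ × ℝ)) (1, 1)).comp
    (Measure.measurePreserving_swap (μ := (volume : Measure ℝ)) (ν := (volume : Measure ℝ)))

theorem RregIoc_succ (j : ℕ) :
    RregIoc (j + 2) = (Set.Ioc (0 : ℝ) 1 ×ˢ Set.Ioc (0 : ℝ) (2 * j + 5) ∪
      Set.Ioc (1 : ℝ) (2 * j + 4) ×ˢ Set.Ioc (0 : ℝ) 1) ∪ swapSub ⁻¹' RregIoc (j + 1) := by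
  ext ⟨x, y⟩
  simp only [RregIoc, swapSub, mem_union, mem_preimage, mem_iUnion, mem_prod, mem_Ioc,
    Finset.mem_Icc, Prod.swap_prod_mk, Prod.mk_sub_mk, exists_prop]
  constructor
  · rintro ⟨i, ⟨h1, h2⟩, ⟨hx0, hx⟩, hy0, hy⟩
    rcases h1.eq_or_lt with rfl | h1
    · rw [ab_succ_one] at hx hy
      push_cast at hx hy
      exact Or.inl (Or.inl ⟨⟨hx0, by linarith⟩, hy0, by linarith⟩)
    · rw [ab_succ_succ j i h1] at hx hy
      obtain ⟨ha, hb⟩ := ab_fst_le_snd_le j (j + 4 - i) (by omega) (by omega)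
      have ha' : ((ab (j + 1) (j + 4 - i)).1 : ℝ) ≤ 2 * j + 2 := by exact_mod_cast ha
      have hb' : ((ab (j + 1) (j + 4 - i)).2 : ℝ) ≤ 2 * j + 3 := by exact_mod_cast hb
      push_cast at hx hy
      rcases le_or_gt x 1 with hx1 | hx1
      · exact Or.inl (Or.inl ⟨⟨hx0, hx1⟩, hy0, by linarith⟩)
      rcases le_or_gt y 1 with hy1 | hy1
      · exact Or.inl (Or.inr ⟨⟨hx1, by linarith⟩, hy0, hy1⟩)
      exact Or.inr ⟨j + 4 - i, ⟨by omega, by omega⟩, ⟨by linarith, by linarith⟩,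
        by linarith, by linarith⟩
  · rintro ((⟨⟨hx0, hx⟩, hy0, hy⟩ | ⟨⟨hx0, hx⟩, hy0, hy⟩) | ⟨i, ⟨h1, h2⟩, ⟨hy0, hy⟩, hx0, hx⟩)
    · refine ⟨1, ⟨le_rfl, by omega⟩, ?_⟩
      rw [ab_succ_one]
      push_cast
      exact ⟨⟨hx0, hx⟩, hy0, by linarith⟩
    · refine ⟨j + 3, ⟨by omega, by omega⟩, ?_⟩
      rw [ab_succ_succ j _ (by omega), show j + 4 - (j + 3) = 1 by omega, ab_succ_one]
      push_cast
      exact ⟨⟨by linarith, by linarith⟩, hy0, by linarith⟩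
    · refine ⟨j + 4 - i, ⟨by omega, by omega⟩, ?_⟩
      rw [ab_succ_succ j _ (by omega), show j + 4 - (j + 4 - i) = i by omega]
      push_cast
      exact ⟨⟨by linarith, by linarith⟩, by linarith, by linarith⟩

theorem RregIoc_subset_pos (j : ℕ) : RregIoc j ⊆ {p | 0 < p.1 ∧ 0 < p.2} := by
  intro p hp
  simp only [RregIoc, mem_iUnion, mem_prod, mem_Ioc] at hp
  obtain ⟨i, _, ⟨hx, _⟩, hy, _⟩ := hp
  exact ⟨hx, hy⟩

theorem volume_RregIoc_succ (j : ℕ) :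
    volume (RregIoc (j + 2)) = ((4 * j + 8 : ℕ) : ℝ≥0∞) + volume (RregIoc (j + 1)) := by
  rw [RregIoc_succ, measure_union _ (measurePreserving_swapSub.measurable
    (measurableSet_RregIoc _)), measurePreserving_swapSub.measure_preimage
    (measurableSet_RregIoc _).nullMeasurableSet, measure_union _
    (measurableSet_Ioc.prod measurableSet_Ioc)]
  · simp only [Measure.volume_eq_prod, Measure.prod_prod, Real.volume_Ioc]
    congr 1
    rw [← ENNReal.ofReal_mul (by norm_num),
      ← ENNReal.ofReal_mul (by linarith [j.cast_nonneg (α := ℝ)]),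
      ← ENNReal.ofReal_add (by linarith [j.cast_nonneg (α := ℝ)])
        (by linarith [j.cast_nonneg (α := ℝ)]),
      ← ENNReal.ofReal_natCast]
    congr 1
    push_cast
    ring
  · rw [Set.disjoint_left]
    rintro ⟨x, y⟩ ⟨⟨_, hx⟩, _⟩ ⟨⟨hx', _⟩, _⟩
    exact absurd hx (not_le.2 hx')
  · rw [Set.disjoint_left]
    rintro ⟨x, y⟩ h hp
    obtain ⟨hy, hx⟩ := RregIoc_subset_pos _ hp
    simp only [swapSub, Prod.swap_prod_mk, Prod.mk_sub_mk, sub_pos] at hx hy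
    rcases h with ⟨⟨_, h⟩, _⟩ | ⟨_, _, h⟩
    · exact absurd h (not_le.2 hx)
    · exact absurd h (not_le.2 hy)

theorem volume_RregIoc_one : volume (RregIoc 1) = 4 := by
  have h : RregIoc 1 = Set.Ioc (0 : ℝ) 1 ×ˢ Set.Ioc (0 : ℝ) 3 ∪
      Set.Ioc (1 : ℝ) 2 ×ˢ Set.Ioc (0 : ℝ) 1 := by
    have h12 : Finset.Icc 1 (1 + 1) = ({1, 2} : Finset ℕ) := rfl
    ext ⟨x, y⟩
    simp only [RregIoc, h12, Finset.mem_insert, Finset.mem_singleton, iUnion_iUnion_eq_or_left,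
      iUnion_iUnion_eq_left, ab, mem_union, mem_prod, mem_Ioc]
    norm_num
    grind
  rw [h, measure_union _ (measurableSet_Ioc.prod measurableSet_Ioc)]
  · simp only [Measure.volume_eq_prod, Measure.prod_prod, Real.volume_Ioc]
    norm_num
  · rw [Set.disjoint_left]
    rintro ⟨x, y⟩ ⟨⟨_, hx⟩, _⟩ ⟨⟨hx', _⟩, _⟩
    exact absurd hx (not_le.2 hx')

/-- For every integer `j ≥ 1`, the area of `R(j)` equals `2j² + 2j`. -/
theorem stmt_2 (j : ℕ) (hj : 1 ≤ j) :
    volume (Rreg j) = ((2 * j ^ 2 + 2 * j : ℕ) : ℝ≥0∞) := by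
  rw [volume_Rreg_eq_volume_RregIoc]
  induction j, hj using Nat.le_induction with
  | base => rw [volume_RregIoc_one]; norm_num
  | succ n hn ih =>
    obtain ⟨m, rfl⟩ := Nat.exists_eq_add_of_le' hn
    rw [volume_RregIoc_succ, ih, ← Nat.cast_add]
    congr 1
    ring
end

section
/- Let j ≥ 1 be an integer and let S_IX(j) = R(j) ∪ ([0,2j] × [−2j,0]) ∪ ([−(4j+1),0] × [−2j, 2j+1]) be the region of P_IX(j); then Area(S_IX(j)) − N(S_IX(j)) − (22j² + 9j + 1) = 0, where N denotes the number of reflex corners. For an integer m ≥ 2, let S_IX(−m) = R₋(m) ∪ ([0,2m] × [−2m,0]) ∪ ([−(4m−1),0] × [−2m, 2m−1]) be the region of P_IX(−m); then Area(S_IX(−m)) − N(S_IX(−m)) − (22m² − 9m + 1) = 1. In particular, Area minus the number of reflex corners minus the lens space surgery coefficient 22j² + 9j + 1 of k_IX(j) is always 0 or 1. -/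
open MeasureTheory Set ENNReal

/-- The region of `P_IX(j)` for `j ≥ 1`:
`S_IX(j) = R(j) ∪ ([0,2j] × [−2j,0]) ∪ ([−(4j+1),0] × [−2j, 2j+1])`. -/
def SIX (j : ℕ) : Set (ℝ × ℝ) :=
  Rreg j ∪
    Set.Icc (0 : ℝ) (2 * (j : ℝ)) ×ˢ Set.Icc (-(2 * (j : ℝ))) (0 : ℝ) ∪
    Set.Icc (-(4 * (j : ℝ) + 1)) (0 : ℝ) ×ˢ Set.Icc (-(2 * (j : ℝ))) (2 * (j : ℝ) + 1)

/-- The region of `P_IX(−m)` for `m ≥ 2`: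
`S_IX(−m) = R₋(m) ∪ ([0,2m] × [−2m,0]) ∪ ([−(4m−1),0] × [−2m, 2m−1])`. -/
def SIXneg (m : ℕ) : Set (ℝ × ℝ) :=
  Rneg m ∪
    Set.Icc (0 : ℝ) (2 * (m : ℝ)) ×ˢ Set.Icc (-(2 * (m : ℝ))) (0 : ℝ) ∪
    Set.Icc (-(4 * (m : ℝ) - 1)) (0 : ℝ) ×ˢ Set.Icc (-(2 * (m : ℝ))) (2 * (m : ℝ) - 1)

/-- `p` is a reflex corner (concave point) of the closed region `R ⊆ ℝ²`:
there are `ε > 0` and signs `σ, τ ∈ {−1, +1}` such that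
`R ∩ B(p,ε) = {q ∈ B(p,ε) : σ(q₁ − p₁) ≤ 0 or τ(q₂ − p₂) ≤ 0}`. -/
def IsReflexCorner (R : Set (ℝ × ℝ)) (p : ℝ × ℝ) : Prop :=
  ∃ ε : ℝ, 0 < ε ∧ ∃ σ τ : ℝ, (σ = 1 ∨ σ = -1) ∧ (τ = 1 ∨ τ = -1) ∧
    R ∩ Metric.ball p ε =
      {q ∈ Metric.ball p ε | σ * (q.1 - p.1) ≤ 0 ∨ τ * (q.2 - p.2) ≤ 0}

/-- The staircase region `⋃_{i ≤ k} [-d, a i] × [-c, b i]`. -/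
def stair (a b : ℕ → ℝ) (c d : ℝ) (k : ℕ) : Set (ℝ × ℝ) :=
  {p | -d ≤ p.1 ∧ -c ≤ p.2 ∧ ∃ i ≤ k, p.1 ≤ a i ∧ p.2 ≤ b i}

section stair

variable {a b : ℕ → ℝ} {c d : ℝ}

lemma stair_zero : stair a b c d 0 = Icc (-d) (a 0) ×ˢ Icc (-c) (b 0) := by
  ext ⟨x, y⟩
  simp only [stair, mem_ofPred_eq, mem_prod, mem_Icc, Nat.le_zero, exists_eq_left]
  tauto

lemma stair_succ (ha : StrictMono a) (hb : StrictAnti b) (hd : -d < a 0) (k : ℕ) :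
    stair a b c d (k + 1) =
      stair a b c d k ∪ Ioc (a k) (a (k + 1)) ×ˢ Icc (-c) (b (k + 1)) := by
  ext ⟨x, y⟩
  simp only [stair, mem_ofPred_eq, mem_union, mem_prod, mem_Icc, mem_Ioc]
  constructor
  · rintro ⟨hx, hy, i, hi, hxi, hyi⟩
    rcases Nat.lt_or_eq_of_le hi with h | rfl
    · exact Or.inl ⟨hx, hy, i, by omega, hxi, hyi⟩
    · rcases le_or_gt x (a k) with h | h
      · exact Or.inl ⟨hx, hy, k, le_rfl, h, hyi.trans (hb.antitone k.le_succ)⟩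
      · exact Or.inr ⟨⟨h, hxi⟩, hy, hyi⟩
  · rintro (⟨hx, hy, i, hi, hxi, hyi⟩ | ⟨⟨hx, hxk⟩, hy, hyk⟩)
    · exact ⟨hx, hy, i, by omega, hxi, hyi⟩
    · exact ⟨by linarith [ha.monotone k.zero_le], hy, k + 1, le_rfl, hxk, hyk⟩

lemma volume_stair (ha : StrictMono a) (hb : StrictAnti b) (hd : -d < a 0) (k : ℕ)
    (hc : -c < b k) (F : ℕ → ℝ) (hF0 : F 0 = (a 0 + d) * (b 0 + c))
    (hF : ∀ i < k, F (i + 1) = F i + (a (i + 1) - a i) * (b (i + 1) + c)) :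
    volume (stair a b c d k) = ENNReal.ofReal (F k) ∧ 0 ≤ F k := by
  induction k with
  | zero =>
    have h1 : 0 ≤ a 0 + d := by linarith
    have h2 : 0 ≤ b 0 + c := by linarith
    refine ⟨?_, hF0 ▸ mul_nonneg h1 h2⟩
    rw [stair_zero, Measure.volume_eq_prod, Measure.prod_prod, Real.volume_Icc, Real.volume_Icc,
      hF0, ENNReal.ofReal_mul h1, sub_neg_eq_add, sub_neg_eq_add]
  | succ k ih =>
    obtain ⟨hv, hp⟩ := ih (hc.trans (hb k.lt_succ_self)) fun i hi => hF i (by omega)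
    have h1 : 0 ≤ a (k + 1) - a k := by linarith [ha k.lt_succ_self]
    have h2 : 0 ≤ b (k + 1) + c := by linarith
    have hdisj : Disjoint (stair a b c d k) (Ioc (a k) (a (k + 1)) ×ˢ Icc (-c) (b (k + 1))) := by
      rw [Set.disjoint_left]
      rintro ⟨x, y⟩ ⟨-, -, i, hi, hxi, -⟩ ⟨⟨hx, -⟩, -⟩
      exact absurd (hxi.trans (ha.monotone hi)) (not_le.2 hx)
    rw [stair_succ ha hb hd, measure_union hdisj (measurableSet_Ioc.prod measurableSet_Icc), hv,
      Measure.volume_eq_prod, Measure.prod_prod, Real.volume_Ioc, Real.volume_Icc,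
      hF k k.lt_succ_self, ENNReal.ofReal_add hp (mul_nonneg h1 h2), ENNReal.ofReal_mul h1,
      sub_neg_eq_add]
    exact ⟨rfl, add_nonneg hp (mul_nonneg h1 h2)⟩

lemma mem_ball_real_prod {x y u v ε : ℝ} :
    (x, y) ∈ Metric.ball ((u, v) : ℝ × ℝ) ε ↔ |x - u| < ε ∧ |y - v| < ε := by
  simp [Metric.mem_ball, Prod.dist_eq, Real.dist_eq]

lemma isReflexCorner_stair_of_lt (ha : StrictMono a) (hb : StrictAnti b) (hd : -d < a 0) {k : ℕ}
    (hc : -c < b k) {i : ℕ} (hi : i < k) :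
    IsReflexCorner (stair a b c d k) (a i, b (i + 1)) := by
  have h1 : a i < a (i + 1) := ha i.lt_succ_self
  have h2 : b (i + 1) < b i := hb i.lt_succ_self
  have h3 : a 0 ≤ a i := ha.monotone i.zero_le
  have h4 : b k ≤ b (i + 1) := hb.antitone (Nat.succ_le_of_lt hi)
  refine ⟨min (min (a (i + 1) - a i) (b i - b (i + 1))) (min (a i + d) (b (i + 1) + c)),
    ?_, 1, 1, Or.inl rfl, Or.inl rfl, ?_⟩
  · simp only [lt_min_iff]
    refine ⟨⟨?_, ?_⟩, ?_, ?_⟩ <;> linarith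
  · ext ⟨x, y⟩
    rw [mem_inter_iff, mem_ofPred_eq, and_comm, and_congr_right_iff, mem_ball_real_prod]
    simp only [lt_min_iff, abs_lt, stair, mem_ofPred_eq]
    rintro ⟨hx, hy⟩
    constructor
    · rintro ⟨-, -, m, -, hxm, hym⟩
      rcases Nat.lt_or_ge i m with h | h
      · exact Or.inr (by linarith [hb.antitone (Nat.succ_le_of_lt h)])
      · exact Or.inl (by linarith [ha.monotone h])
    · rintro (h | h)
      · exact ⟨by linarith, by linarith, i, hi.le, by linarith, by linarith⟩
      · exact ⟨by linarith, by linarith, i + 1, hi, by linarith, by linarith⟩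

lemma exists_of_isReflexCorner_stair (ha : StrictMono a) (hb : StrictAnti b) {k : ℕ} {p : ℝ × ℝ}
    (hp : IsReflexCorner (stair a b c d k) p) : ∃ i < k, (a i, b (i + 1)) = p := by
  obtain ⟨u, v⟩ := p
  obtain ⟨ε, hε, σ, τ, hσ, hτ, h⟩ := hp
  have key : ∀ s t : ℝ, |s| < ε → |t| < ε →
      ((u + s, v + t) ∈ stair a b c d k ↔ σ * s ≤ 0 ∨ τ * t ≤ 0) := by
    intro s t hs ht
    have hball : (u + s, v + t) ∈ Metric.ball ((u, v) : ℝ × ℝ) ε := by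
      rw [mem_ball_real_prod, add_sub_cancel_left, add_sub_cancel_left]
      exact ⟨hs, ht⟩
    have := Set.ext_iff.1 h (u + s, v + t)
    simpa only [mem_inter_iff, mem_ofPred_eq, hball, and_true, true_and, add_sub_cancel_left]
      using this
  have hε2 : |ε / 2| < ε := by rw [abs_of_pos (by positivity)]; linarith
  have hε2' : |-(ε / 2)| < ε := by rwa [abs_neg]
  have h0 : |(0 : ℝ)| < ε := by simpa
  have hσ1 : σ = 1 := by
    rcases hσ with rfl | rfl
    · rfl
    exfalso
    have hτt : ∃ t : ℝ, |t| < ε ∧ 0 < τ * t := by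
      rcases hτ with rfl | rfl
      · exact ⟨ε / 2, hε2, by linarith⟩
      · exact ⟨-(ε / 2), hε2', by linarith⟩
    obtain ⟨t, ht, hτt⟩ := hτt
    obtain ⟨-, hy, i, hi, hxi, hyi⟩ := (key (ε / 2) t hε2 ht).2 (Or.inl (by linarith))
    obtain ⟨hx, -⟩ := (key (-(ε / 2)) 0 hε2' h0).2 (Or.inr (by simp))
    have hnot := mt (key (-(ε / 2)) t hε2' ht).1 (by push Not; constructor <;> linarith)
    exact hnot ⟨hx, hy, i, hi, by dsimp only at *; linarith, hyi⟩
  subst hσ1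
  have hτ1 : τ = 1 := by
    rcases hτ with rfl | rfl
    · rfl
    exfalso
    obtain ⟨hx, -, i, hi, hxi, hyi⟩ := (key (ε / 2) (ε / 2) hε2 hε2).2 (Or.inr (by linarith))
    obtain ⟨-, hy, -⟩ := (key 0 (-(ε / 2)) h0 hε2').2 (Or.inl (by simp))
    have hnot := mt (key (ε / 2) (-(ε / 2)) hε2 hε2').1 (by push Not; constructor <;> linarith)
    exact hnot ⟨hx, hy, i, hi, hxi, by dsimp only at *; linarith⟩
  subst hτ1
  obtain ⟨hu, hv, -⟩ := (key 0 0 h0 h0).2 (by simp)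
  have hmax : ∀ i ≤ k, u < a i → v < b i → False := by
    intro i hi hui hvi
    set δ := min (ε / 2) (min (a i - u) (b i - v))
    have hδ0 : 0 < δ := lt_min (by linarith) (lt_min (by linarith) (by linarith))
    have h1 : δ ≤ ε / 2 := min_le_left _ _
    have h2 : δ ≤ a i - u := (min_le_right _ _).trans (min_le_left _ _)
    have h3 : δ ≤ b i - v := (min_le_right _ _).trans (min_le_right _ _)
    have hδε : |δ| < ε := by rw [abs_of_pos hδ0]; linarith
    rcases (key δ δ hδε hδε).1
      ⟨by dsimp only at *; linarith, by dsimp only at *; linarith, i, hi,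
        by dsimp only; linarith, by dsimp only; linarith⟩ with h | h <;> linarith
  obtain ⟨-, -, i, hi, hxi, hyi⟩ := (key (ε / 2) 0 hε2 h0).2 (Or.inr (by simp))
  obtain ⟨-, -, l, hl, hxl, hyl⟩ := (key 0 (ε / 2) h0 hε2).2 (Or.inl (by simp))
  simp only [add_zero] at hu hv hxi hyi hxl hyl
  have hex : ∃ i, u < a i := ⟨i, by linarith⟩
  obtain ⟨m, hm, hmin⟩ : ∃ m, u < a m ∧ ∀ n < m, a n ≤ u :=
    ⟨Nat.find hex, Nat.find_spec hex, fun n hn => not_lt.1 (Nat.find_min hex hn)⟩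
  have hmi : m ≤ i := by
    by_contra! hlt
    linarith [hmin i hlt]
  have hvm : v ≤ b m := hyi.trans (hb.antitone hmi)
  have hlm : l < m := by
    by_contra! hle
    exact hmax m (by omega) hm (by linarith [hb.antitone hle])
  obtain ⟨n, rfl⟩ : ∃ n, m = n + 1 := ⟨m - 1, by omega⟩
  refine ⟨n, by omega, Prod.ext ?_ ?_⟩
  · exact le_antisymm (hmin n n.lt_succ_self) (hxl.trans (ha.monotone (by omega)))
  · exact le_antisymm (not_lt.1 fun hlt => hmax (n + 1) (by omega) hm hlt) hvm

lemma ncard_isReflexCorner_stair (ha : StrictMono a) (hb : StrictAnti b) (hd : -d < a 0) {k : ℕ}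
    (hc : -c < b k) : Set.ncard {p | IsReflexCorner (stair a b c d k) p} = k := by
  have himage : {p | IsReflexCorner (stair a b c d k) p} =
      (fun i => (a i, b (i + 1))) '' (Finset.range k : Set ℕ) := by
    ext p
    simp only [mem_ofPred_eq, mem_image, Finset.coe_range, mem_Iio]
    constructor
    · exact exists_of_isReflexCorner_stair ha hb
    · rintro ⟨i, hi, rfl⟩
      exact isReflexCorner_stair_of_lt ha hb hd hc hi
  rw [himage, Set.ncard_image_of_injective, Set.ncard_coe_finset, Finset.card_range]
  intro i l hil
  exact ha.injective (congrArg Prod.fst hil)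

lemma union_eq_stair (ha : StrictMono a) (hb : StrictAnti b) {k : ℕ} (ha0 : 0 ≤ a 0)
    (hbk : 0 ≤ b k) (hc : 0 ≤ c) (hd : 0 ≤ d) :
    (⋃ i ∈ Finset.Icc 1 (k + 1), Icc 0 (a (i - 1)) ×ˢ Icc 0 (b (i - 1))) ∪
      Icc 0 (a k) ×ˢ Icc (-c) 0 ∪ Icc (-d) 0 ×ˢ Icc (-c) (b 0) = stair a b c d k := by
  ext ⟨x, y⟩
  simp only [stair, mem_union, mem_iUnion, Finset.mem_Icc, mem_prod, mem_Icc, mem_ofPred_eq,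
    exists_prop]
  constructor
  · rintro ((⟨i, hi, ⟨hx, hxi⟩, hy, hyi⟩ | ⟨⟨hx, hxk⟩, hy, hy0⟩) | ⟨⟨hx, hx0⟩, hy, hy0⟩)
    · exact ⟨by linarith, by linarith, i - 1, by omega, hxi, hyi⟩
    · exact ⟨by linarith, hy, k, le_rfl, hxk, by linarith⟩
    · exact ⟨hx, hy, 0, k.zero_le, by linarith, hy0⟩
  · rintro ⟨hx, hy, i, hi, hxi, hyi⟩
    rcases le_total x 0 with hx0 | hx0
    · exact Or.inr ⟨⟨hx, hx0⟩, hy, hyi.trans (hb.antitone i.zero_le)⟩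
    rcases le_total y 0 with hy0 | hy0
    · exact Or.inl (Or.inr ⟨⟨hx0, hxi.trans (ha.monotone hi)⟩, hy, hy0⟩)
    · exact Or.inl (Or.inl ⟨i + 1, by omega, ⟨hx0, hxi⟩, hy0, hyi⟩)

end stair

lemma ab_succ_eq (j : ℕ) : ∀ i : ℕ, i ≤ j + 1 → ab (j + 1) (i + 1) =
    (if 2 * i ≤ j then 2 * (i : ℤ) + 1 else 2 * i,
      if 2 * i ≤ j + 2 then 2 * (j : ℤ) + 3 - 2 * i else 2 * j + 4 - 2 * i) := by
  induction j with
  | zero =>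
    intro i hi
    interval_cases i <;> simp [ab]
  | succ j ih =>
    intro i hi
    rcases Nat.eq_zero_or_pos i with rfl | hpos
    · simp only [ab, if_true, zero_add]
      simp
      ring
    · have hidx : j + 2 + 2 - (i + 1) = (j + 2 - i) + 1 := by omega
      rw [ab, if_neg (by omega), hidx, ih _ (by omega)]
      ext <;> dsimp only <;> split_ifs <;> omega

/-- The width of the `i`-th step of `R(j)`, counted from `i = 0`. -/
noncomputable def stepWidth (j i : ℕ) : ℝ := if 2 * i + 1 ≤ j then 2 * i + 1 else 2 * i

/-- The height of the `i`-th step of `R(j)`, counted from `i = 0`. -/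
noncomputable def stepHeight (j i : ℕ) : ℝ :=
  if 2 * i ≤ j + 1 then 2 * j + 1 - 2 * i else 2 * j + 2 - 2 * i

/-- The area of the part of `S_IX(j)` to the left of the right end of the `k`-th step,
counted from `k = 0`. -/
noncomputable def partialArea (j k : ℕ) : ℝ :=
  if 2 * k + 1 ≤ j then (4 * j + 2) * (4 * j + 1) + 2 * k * (4 * j - 1) - 2 * k * (k - 1)
  else 22 * j ^ 2 + 10 * j + 1 - (8 * j * (j - k) - 2 * (j * (j - 1) - k * (k - 1)))

lemma strictMono_stepWidth (j : ℕ) : StrictMono (stepWidth j) := by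
  refine strictMono_nat_of_lt_succ fun i => ?_
  unfold stepWidth
  push_cast
  split_ifs <;> first | omega | linarith

lemma strictAnti_stepHeight (j : ℕ) : StrictAnti (stepHeight j) := by
  refine strictAnti_nat_of_succ_lt fun i => ?_
  unfold stepHeight
  push_cast
  split_ifs <;> first | omega | linarith

lemma partialArea_succ (j k : ℕ) : partialArea j (k + 1) = partialArea j k +
    (stepWidth j (k + 1) - stepWidth j k) * (stepHeight j (k + 1) + 2 * j) := by
  unfold partialArea stepWidth stepHeight
  by_cases h1 : 2 * (k + 1) + 1 ≤ j
  · rw [if_pos h1, if_pos (by omega), if_pos h1, if_pos (by omega), if_pos (by omega)]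
    push_cast
    ring
  by_cases h2 : 2 * k + 1 ≤ j
  · rw [if_neg h1, if_pos h2, if_neg h1, if_pos h2, if_pos (by omega)]
    obtain rfl | rfl : j = 2 * k + 1 ∨ j = 2 * k + 2 := by omega
    all_goals push_cast; ring
  · rw [if_neg h1, if_neg h2, if_neg h1, if_neg h2, if_neg (by omega)]
    push_cast
    ring

lemma SIX_eq_stair {j : ℕ} (hj : 1 ≤ j) :
    SIX j = stair (stepWidth j) (stepHeight j) (2 * j) (4 * j + 1) j := by
  have hw : stepWidth j j = 2 * j := if_neg (by omega)
  have hh : stepHeight j 0 = 2 * j + 1 := by simp [stepHeight]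
  rw [← union_eq_stair (strictMono_stepWidth j) (strictAnti_stepHeight j), hw, hh, SIX, Rreg]
  · congr 2
    refine iUnion₂_congr fun i hi => ?_
    rw [Finset.mem_Icc] at hi
    obtain ⟨j, rfl⟩ : ∃ n, j = n + 1 := ⟨j - 1, by omega⟩
    obtain ⟨i, rfl⟩ : ∃ n, i = n + 1 := ⟨i - 1, by omega⟩
    rw [ab_succ_eq j i (by omega)]
    congr 2
    · simp [stepWidth]
    · simp only [stepHeight, Nat.add_sub_cancel]
      push_cast
      congr 1 <;> ring
  · unfold stepWidth; split_ifs <;> simp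
  · unfold stepHeight; split_ifs <;> first | omega | linarith
  · positivity
  · positivity

lemma SIXneg_eq_stair (n : ℕ) :
    SIXneg (n + 1) = stair (fun i => 2 * (i : ℝ) + 2) (fun i => 2 * (n : ℝ) + 1 - 2 * i)
      (2 * n + 2) (4 * n + 3) n := by
  rw [← union_eq_stair, SIXneg, Rneg]
  · congr 1
    · congr 1
      · refine iUnion₂_congr fun i hi => ?_
        rw [Finset.mem_Icc] at hi
        rw [Nat.cast_sub hi.1]
        push_cast
        ring_nf
      · push_cast
        ring_nf
    · push_cast
      ring_nf
  · exact strictMono_nat_of_lt_succ fun i => by push_cast; linarith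
  · exact strictAnti_nat_of_succ_lt fun i => by push_cast; linarith
  · positivity
  · linarith
  · positivity
  · positivity

/-- Area minus number of reflex corners minus the lens space surgery coefficient
`22j² + 9j + 1` of `k_IX(j)`: it is `0` for `j ≥ 1` (i.e. `Area = N + (22j²+9j+1)`)
and `1` for `j = −m ≤ −2` (i.e. `Area = N + (22m²−9m+1) + 1`). -/
theorem stmt_3 :
    (∀ j : ℕ, 1 ≤ j →
      volume (SIX j) =
        (((Set.ncard {p : ℝ × ℝ | IsReflexCorner (SIX j) p}) +
          (22 * j ^ 2 + 9 * j + 1) : ℕ) : ℝ≥0∞)) ∧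
    (∀ m : ℕ, 2 ≤ m →
      volume (SIXneg m) =
        (((Set.ncard {p : ℝ × ℝ | IsReflexCorner (SIXneg m) p}) +
          (22 * m ^ 2 - 9 * m + 1) + 1 : ℕ) : ℝ≥0∞)) := by
  refine ⟨fun j hj => ?_, fun m hm => ?_⟩
  · have ha := strictMono_stepWidth j
    have hb := strictAnti_stepHeight j
    have hd : -(4 * (j : ℝ) + 1) < stepWidth j 0 := by
      have : 0 ≤ stepWidth j 0 := by unfold stepWidth; split_ifs <;> simp
      linarith [j.cast_nonneg (α := ℝ)]
    have hc : -(2 * (j : ℝ)) < stepHeight j j := by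
      have : 1 ≤ stepHeight j j := by unfold stepHeight; split_ifs <;> linarith
      linarith [j.cast_nonneg (α := ℝ)]
    rw [SIX_eq_stair hj, ncard_isReflexCorner_stair ha hb hd hc,
      (volume_stair ha hb hd j hc (partialArea j) ?_ fun i _ => partialArea_succ j i).1,
      ← ENNReal.ofReal_natCast]
    · congr 1
      rw [partialArea, if_neg (by omega)]
      push_cast
      ring
    · simp only [partialArea, stepWidth, stepHeight]
      rw [if_pos (by omega), if_pos (by omega), if_pos (by omega)]
      push_cast
      ring
  · obtain ⟨n, rfl⟩ : ∃ n, m = n + 1 := ⟨m - 1, by omega⟩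
    have ha : StrictMono fun i : ℕ => 2 * (i : ℝ) + 2 :=
      strictMono_nat_of_lt_succ fun i => by push_cast; linarith
    have hb : StrictAnti fun i : ℕ => 2 * (n : ℝ) + 1 - 2 * i :=
      strictAnti_nat_of_succ_lt fun i => by push_cast; linarith
    have hn : (0 : ℝ) ≤ n := n.cast_nonneg
    have hd : -(4 * (n : ℝ) + 3) < 2 * ((0 : ℕ) : ℝ) + 2 := by push_cast; linarith
    have hc : -(2 * (n : ℝ) + 2) < 2 * (n : ℝ) + 1 - 2 * n := by linarith
    rw [SIXneg_eq_stair, ncard_isReflexCorner_stair ha hb hd hc,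
      (volume_stair ha hb hd n hc
        (fun k => (4 * n + 5) * (4 * n + 3) + 2 * k * (4 * n + 3) - 2 * k * (k + 1)) ?_ ?_).1,
      ← ENNReal.ofReal_natCast]
    · have hsub : 22 * (n + 1) ^ 2 - 9 * (n + 1) = 22 * n ^ 2 + 35 * n + 13 := by
        rw [Nat.sub_eq_iff_eq_add (by nlinarith)]
        ring
      rw [hsub]
      congr 1
      push_cast
      ring
    · push_cast
      ring
    · intro i _
      push_cast
      ring
end

section
/- For every integer j ≥ 1, the number of even lattice points lying in the topological interior of the region R(j) = ⋃_{i=1}^{j+1} [0, a_i^{(j)}] × [0, b_i^{(j)}] ⊆ ℝ² equals j(j−1), which is the Seifert genus of the torus knot T(j, 2j+1). -/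
open MeasureTheory Set ENNReal

/-- `p ∈ ℝ²` is an even lattice point: `p = (x,y)` with `x, y ∈ ℤ` and `x + y` even. -/
def IsEvenLatticePt (p : ℝ × ℝ) : Prop :=
  ∃ x y : ℤ, p.1 = (x : ℝ) ∧ p.2 = (y : ℝ) ∧ Even (x + y)

/-- The union of the open lower-left quadrants with corners `ab j i`. -/
def UnderStaircase (j : ℕ) (x y : ℤ) : Prop :=
  ∃ i ∈ Finset.Icc 1 (j + 1), x < (ab j i).1 ∧ y < (ab j i).2

lemma underStaircase_one (x y : ℤ) :
    UnderStaircase 1 x y ↔ (x < 1 ∧ y < 3) ∨ (x < 2 ∧ y < 1) := by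
  constructor
  · rintro ⟨i, hi, hx, hy⟩
    rw [Finset.mem_Icc] at hi
    obtain rfl | rfl : i = 1 ∨ i = 2 := by omega
    · exact Or.inl ⟨by simpa [ab] using hx, by simpa [ab] using hy⟩
    · exact Or.inr ⟨by simpa [ab] using hx, by simpa [ab] using hy⟩
  · rintro (⟨hx, hy⟩ | ⟨hx, hy⟩)
    · exact ⟨1, by simp, by simpa [ab] using hx, by simpa [ab] using hy⟩
    · exact ⟨2, by simp, by simpa [ab] using hx, by simpa [ab] using hy⟩

lemma ab_add_two (j i : ℕ) (hi : i ≠ 1) :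
    ab (j + 2) i = ((ab (j + 1) (j + 2 + 2 - i)).2 + 1, (ab (j + 1) (j + 2 + 2 - i)).1 + 1) := by
  rw [ab, if_neg hi]

lemma underStaircase_add_two (j : ℕ) (x y : ℤ) :
    UnderStaircase (j + 2) x y ↔
      (x < 1 ∧ y < 2 * (j + 2) + 1) ∨ UnderStaircase (j + 1) (y - 1) (x - 1) := by
  constructor
  · rintro ⟨i, hi, hx, hy⟩
    rw [Finset.mem_Icc] at hi
    by_cases h : i = 1
    · subst h
      exact Or.inl ⟨by simpa [ab] using hx, by simpa [ab] using hy⟩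
    · rw [ab_add_two j i h] at hx hy
      refine Or.inr ⟨j + 2 + 2 - i, by rw [Finset.mem_Icc]; omega, ?_, ?_⟩
      · dsimp only at hy; linarith
      · dsimp only at hx; linarith
  · rintro (⟨hx, hy⟩ | ⟨i, hi, hx, hy⟩)
    · exact ⟨1, by simp, by simpa [ab] using hx, by simpa [ab] using hy⟩
    · rw [Finset.mem_Icc] at hi
      refine ⟨j + 2 + 2 - i, by rw [Finset.mem_Icc]; omega, ?_⟩
      rw [ab_add_two j _ (by omega), show j + 2 + 2 - (j + 2 + 2 - i) = i by omega]
      dsimp only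
      constructor <;> linarith

lemma underStaircase_of_nonpos (j : ℕ) (x y : ℤ) :
    (x ≤ 0 → (UnderStaircase (j + 1) x y ↔ y < 2 * j + 3)) ∧
      (y ≤ 0 → (UnderStaircase (j + 1) x y ↔ x < 2 * j + 2)) := by
  induction j generalizing x y with
  | zero =>
    rw [zero_add, underStaircase_one]
    constructor <;> intro h <;> push_cast <;> omega
  | succ j ih =>
    rw [underStaircase_add_two]
    constructor <;> intro h
    · rw [(ih (y - 1) (x - 1)).2 (by omega)]
      push_cast
      omega
    · rw [(ih (y - 1) (x - 1)).1 (by omega)]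
      push_cast
      omega

lemma exists_finset_underStaircase (j : ℕ) :
    ∃ F : Finset (ℤ × ℤ),
      (∀ x y : ℤ, (x, y) ∈ F ↔ 0 < x ∧ 0 < y ∧ Even (x + y) ∧ UnderStaircase (j + 1) x y) ∧
        F.card = (j + 1) * j := by
  induction j with
  | zero =>
    refine ⟨∅, fun x y ↦ ?_, by simp⟩
    rw [zero_add, underStaircase_one]
    simp only [Finset.notMem_empty, false_iff]
    omega
  | succ j ih =>
    obtain ⟨F, hF, hcard⟩ := ih
    let f : ℕ → ℤ × ℤ := fun k ↦ (2 * k + 1, 1)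
    let g : ℕ → ℤ × ℤ := fun k ↦ (1, 2 * k + 3)
    let s : ℤ × ℤ → ℤ × ℤ := fun p ↦ (p.2 + 1, p.1 + 1)
    have hf : f.Injective := fun a b h ↦ by simpa [f] using h
    have hg : g.Injective := fun a b h ↦ by simpa [g] using h
    have hs : s.Injective := fun a b h ↦ by
      simp only [s, Prod.mk.injEq] at h
      exact Prod.ext (by linarith [h.2]) (by linarith [h.1])
    have mem_s (x y : ℤ) : (x, y) ∈ F.image s ↔ (y - 1, x - 1) ∈ F := by
      rw [← hs.mem_finset_image (s := F)]
      simp [s]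
    have mem_f (x y : ℤ) : (x, y) ∈ (Finset.range (j + 2)).image f ↔
        0 < x ∧ x < 2 * j + 4 ∧ Odd x ∧ y = 1 := by
      simp only [Finset.mem_image, Finset.mem_range, f, Prod.mk.injEq]
      constructor
      · rintro ⟨k, hk, rfl, rfl⟩
        exact ⟨by omega, by omega, ⟨k, rfl⟩, rfl⟩
      · rintro ⟨h0, h1, ⟨k, rfl⟩, rfl⟩
        exact ⟨k.toNat, by omega, by omega, rfl⟩
    have mem_g (x y : ℤ) : (x, y) ∈ (Finset.range j).image g ↔
        x = 1 ∧ 1 < y ∧ y < 2 * j + 3 ∧ Odd y := by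
      simp only [Finset.mem_image, Finset.mem_range, g, Prod.mk.injEq]
      constructor
      · rintro ⟨k, hk, rfl, rfl⟩
        exact ⟨rfl, by omega, by omega, ⟨k + 1, by ring⟩⟩
      · rintro ⟨rfl, h0, h1, ⟨k, rfl⟩⟩
        exact ⟨(k - 1).toNat, by omega, rfl, by omega⟩
    refine ⟨F.image s ∪ ((Finset.range (j + 2)).image f ∪ (Finset.range j).image g), ?_, ?_⟩
    · intro x y
      rw [Finset.mem_union, Finset.mem_union, mem_s, mem_f, mem_g, hF, underStaircase_add_two]
      have h := underStaircase_of_nonpos j (y - 1) (x - 1)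
      simp only [Int.even_iff, Int.odd_iff]
      by_cases hx : x = 1
      · have := h.2 (by omega)
        rw [this]
        omega
      · by_cases hy : y = 1
        · have := h.1 (by omega)
          rw [this]
          omega
        · generalize UnderStaircase (j + 1) (y - 1) (x - 1) = P
          by_cases hP : P <;> simp only [hP, and_true, and_false, or_true, or_false, false_or] <;> omega
    · rw [Finset.card_union_of_disjoint, Finset.card_union_of_disjoint,
        Finset.card_image_of_injective _ hs, Finset.card_image_of_injective _ hf,
        Finset.card_image_of_injective _ hg, hcard, Finset.card_range, Finset.card_range]
      · ring
      · rw [Finset.disjoint_left]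
        rintro ⟨x, y⟩ h1 h2
        rw [mem_f] at h1
        rw [mem_g] at h2
        omega
      · rw [Finset.disjoint_left]
        rintro ⟨x, y⟩ h1 h2
        rw [mem_s, hF] at h1
        rw [Finset.mem_union, mem_f, mem_g] at h2
        omega

lemma mem_interior_Rreg (j : ℕ) (x y : ℤ) :
    ((x : ℝ), (y : ℝ)) ∈ interior (Rreg j) ↔ 0 < x ∧ 0 < y ∧ UnderStaircase j x y := by
  constructor
  · intro h
    obtain ⟨ε, hε, hball⟩ := Metric.mem_nhds_iff.1 (mem_interior_iff_mem_nhds.1 h)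
    have key (t : ℝ) (ht : |t| < ε) : ((x : ℝ) + t, (y : ℝ) + t) ∈ Rreg j := by
      apply hball
      simpa [Prod.dist_eq, Real.dist_eq] using ht
    have hpos := key (ε / 2) (by rw [abs_of_pos (by linarith)]; linarith)
    have hneg := key (-(ε / 2)) (by rw [abs_neg, abs_of_pos (by linarith)]; linarith)
    simp only [Rreg, mem_iUnion, mem_prod, mem_Icc, exists_prop] at hpos hneg
    obtain ⟨i, hi, ⟨-, hx⟩, -, hy⟩ := hpos
    obtain ⟨_, _, ⟨hx0, -⟩, hy0, -⟩ := hneg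
    refine ⟨?_, ?_, i, hi, ?_, ?_⟩
    · exact_mod_cast (by linarith : (0 : ℝ) < x)
    · exact_mod_cast (by linarith : (0 : ℝ) < y)
    · exact_mod_cast (by linarith : (x : ℝ) < (ab j i).1)
    · exact_mod_cast (by linarith : (y : ℝ) < (ab j i).2)
  · rintro ⟨hx0, hy0, i, hi, hx, hy⟩
    have hsub : Icc (0 : ℝ) (ab j i).1 ×ˢ Icc (0 : ℝ) (ab j i).2 ⊆ Rreg j :=
      subset_biUnion_of_mem
        (u := fun i ↦ Icc (0 : ℝ) ((ab j i).1 : ℝ) ×ˢ Icc (0 : ℝ) ((ab j i).2 : ℝ)) hi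
    apply interior_mono hsub
    rw [interior_prod_eq, interior_Icc, interior_Icc]
    exact ⟨⟨Int.cast_pos.2 hx0, Int.cast_lt.2 hx⟩, Int.cast_pos.2 hy0, Int.cast_lt.2 hy⟩

/-- For every integer `j ≥ 1`, the number of even lattice points in the interior of
`R(j)` equals `j(j−1)`, the Seifert genus of the torus knot `T(j, 2j+1)`. -/
theorem stmt_5 (j : ℕ) (hj : 1 ≤ j) :
    Set.ncard {p : ℝ × ℝ | IsEvenLatticePt p ∧ p ∈ interior (Rreg j)} = j * (j - 1) := by
  obtain ⟨j, rfl⟩ := Nat.exists_eq_add_of_le' hj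
  obtain ⟨F, hF, hcard⟩ := exists_finset_underStaircase j
  let c : ℤ × ℤ → ℝ × ℝ := Prod.map (↑) (↑)
  have hc : c.Injective := Int.cast_injective.prodMap Int.cast_injective
  have hset : {p : ℝ × ℝ | IsEvenLatticePt p ∧ p ∈ interior (Rreg (j + 1))} = c '' F := by
    ext ⟨u, v⟩
    constructor
    · rintro ⟨⟨x, y, hx, hy, he⟩, hp⟩
      dsimp only at hx hy
      subst hx hy
      obtain ⟨hx0, hy0, hU⟩ := (mem_interior_Rreg _ x y).1 hp
      exact ⟨(x, y), (hF x y).2 ⟨hx0, hy0, he, hU⟩, rfl⟩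
    · rintro ⟨⟨x, y⟩, hp, h⟩
      obtain ⟨hx0, hy0, he, hU⟩ := (hF x y).1 hp
      rw [← h]
      exact ⟨⟨x, y, rfl, rfl, he⟩, (mem_interior_Rreg _ x y).2 ⟨hx0, hy0, hU⟩⟩
  rw [hset, ncard_image_of_injective _ hc, ncard_coe_finset, hcard, Nat.add_sub_cancel]
end

section
/- For every integer m ≥ 2, the number of even lattice points lying in the topological interior of the region R₋(m) = ⋃_{i=1}^{m} [0,2i] × [0, 2m+1−2i] ⊆ ℝ² equals (m−1)², which is the Seifert genus of the torus knot T(m, 2m−1). -/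
open MeasureTheory Set ENNReal

theorem mem_interior_Rneg_iff {m : ℕ} {p : ℝ × ℝ} :
    p ∈ interior (Rneg m) ↔ ∃ i : ℕ, 1 ≤ i ∧ i ≤ m ∧ 0 < p.1 ∧ p.1 < 2 * (i : ℝ) ∧
      0 < p.2 ∧ p.2 < 2 * (m : ℝ) + 1 - 2 * (i : ℝ) := by
  constructor
  · intro h
    rw [mem_interior_iff_mem_nhds, Metric.mem_nhds_iff] at h
    obtain ⟨ε, hε, hball⟩ := h
    have shift_mem (t : ℝ) (ht : |t| < ε) : (p.1 + t, p.2 + t) ∈ Rneg m := by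
      apply hball
      simp [Prod.dist_eq, ht]
    have hpos := shift_mem (ε / 2) (by rw [abs_of_pos] <;> linarith)
    have hneg := shift_mem (-(ε / 2)) (by rw [abs_neg, abs_of_pos] <;> linarith)
    simp only [Rneg, mem_iUnion, mem_prod, mem_Icc, Finset.mem_Icc, exists_prop] at hpos hneg
    obtain ⟨i, ⟨hi₁, hi₂⟩, ⟨-, hx⟩, -, hy⟩ := hpos
    obtain ⟨-, -, ⟨hx', -⟩, hy', -⟩ := hneg
    exact ⟨i, hi₁, hi₂, by linarith, by linarith, by linarith, by linarith⟩
  · rintro ⟨i, hi₁, hi₂, hx, hx', hy, hy'⟩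
    have hsub : Ioo (0 : ℝ) (2 * (i : ℝ)) ×ˢ Ioo (0 : ℝ) (2 * (m : ℝ) + 1 - 2 * (i : ℝ)) ⊆
        Rneg m :=
      (prod_mono Ioo_subset_Icc_self Ioo_subset_Icc_self).trans
        (subset_biUnion_of_mem (u := fun i : ℕ ↦ Icc (0 : ℝ) (2 * (i : ℝ)) ×ˢ
          Icc (0 : ℝ) (2 * (m : ℝ) + 1 - 2 * (i : ℝ))) (Finset.mem_Icc.2 ⟨hi₁, hi₂⟩))
    exact interior_maximal hsub (isOpen_Ioo.prod isOpen_Ioo) ⟨⟨hx, hx'⟩, hy, hy'⟩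

theorem intCast_mem_interior_Rneg_iff {m : ℕ} {x y : ℤ} :
    ((x : ℝ), (y : ℝ)) ∈ interior (Rneg m) ↔ ∃ i : ℕ, 1 ≤ i ∧ i ≤ m ∧ 0 < x ∧ x < 2 * (i : ℤ) ∧
      0 < y ∧ y < 2 * (m : ℤ) + 1 - 2 * (i : ℤ) := by
  rw [mem_interior_Rneg_iff]
  rify

/-- The map sending the part `a + b ≤ m` of the square `[1, m - 1]²` onto the odd-odd points
interior to `Rneg m`, and the rest of the square onto the even-even ones. -/
def squareToEvenLattice (m : ℕ) (q : ℤ × ℤ) : ℤ × ℤ :=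
  if q.1 + q.2 ≤ m then (2 * q.1 - 1, 2 * q.2 - 1) else (2 * (m - q.1), 2 * (m - q.2))

theorem squareToEvenLattice_injective (m : ℕ) : Function.Injective (squareToEvenLattice m) := by
  rintro ⟨a, b⟩ ⟨c, d⟩ h
  simp only [squareToEvenLattice] at h
  split_ifs at h <;> simp only [Prod.mk.injEq] at h ⊢ <;> omega

theorem evenLatticePt_interior_Rneg_eq_image (m : ℕ) :
    {p : ℝ × ℝ | IsEvenLatticePt p ∧ p ∈ interior (Rneg m)} =
      Prod.map ((↑) : ℤ → ℝ) ((↑) : ℤ → ℝ) ∘ squareToEvenLattice m ''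
        (Finset.Icc (1 : ℤ) (m - 1) ×ˢ Finset.Icc (1 : ℤ) (m - 1) : Finset (ℤ × ℤ)) := by
  ext ⟨u, v⟩
  constructor
  · rintro ⟨⟨x, y, rfl, rfl, hxy⟩, hp⟩
    obtain ⟨i, hi₁, hi₂, hx, hx', hy, hy'⟩ := intCast_mem_interior_Rneg_iff.1 hp
    rw [Int.even_add] at hxy
    rcases Int.even_or_odd' x with ⟨k, rfl | rfl⟩
    · obtain ⟨l, rfl⟩ := (hxy.1 (even_two_mul k)).two_dvd
      refine ⟨(m - k, m - l), ?_, ?_⟩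
      · simp only [Finset.coe_product, Finset.coe_Icc, mem_prod, mem_Icc]
        omega
      · have h : ¬ ((m : ℤ) - k + (m - l) ≤ m) := by omega
        simp [squareToEvenLattice, h]
    · have hy_odd : Odd y := by
        rw [← Int.not_even_iff_odd, ← hxy]
        simp
      obtain ⟨l, rfl⟩ := hy_odd
      refine ⟨(k + 1, l + 1), ?_, ?_⟩
      · simp only [Finset.coe_product, Finset.coe_Icc, mem_prod, mem_Icc]
        omega
      · have h : k + 1 + (l + 1) ≤ (m : ℤ) := by omega
        simp only [squareToEvenLattice, h, Function.comp_apply, if_true, Prod.map_apply,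
          Prod.mk.injEq, Int.cast_inj]
        omega
  · rintro ⟨⟨a, b⟩, hab, h⟩
    simp only [Finset.coe_product, Finset.coe_Icc, mem_prod, mem_Icc] at hab
    rw [← h]
    simp only [Function.comp_apply, Prod.map, mem_ofPred_eq, intCast_mem_interior_Rneg_iff]
    refine ⟨⟨_, _, rfl, rfl, ?_⟩, ?_⟩
    · simp only [squareToEvenLattice]
      split_ifs
      · exact ⟨a + b - 1, by ring⟩
      · exact ⟨m - a + (m - b), by ring⟩
    · simp only [squareToEvenLattice]
      split_ifs
      · exact ⟨a.toNat, by omega⟩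
      · exact ⟨(m - a + 1).toNat, by omega⟩

/-- For every integer `m ≥ 2`, the number of even lattice points in the interior of
`R₋(m)` equals `(m−1)²`, the Seifert genus of the torus knot `T(m, 2m−1)`. -/
theorem stmt_6 (m : ℕ) (hm : 2 ≤ m) :
    Set.ncard {p : ℝ × ℝ | IsEvenLatticePt p ∧ p ∈ interior (Rneg m)} = (m - 1) ^ 2 := by
  rw [evenLatticePt_interior_Rneg_eq_image, ncard_image_of_injective _
    ((Int.cast_injective.prodMap Int.cast_injective).comp (squareToEvenLattice_injective m)),
    ncard_coe_finset, Finset.card_product, Int.card_Icc, sq]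
  congr 1 <;> omega
end

section
/- For every integer j ≥ 1, the number of even lattice points lying in the topological interior of the region S_IX(j) = R(j) ∪ ([0,2j] × [−2j,0]) ∪ ([−(4j+1),0] × [−2j, 2j+1]) ⊆ ℝ² equals 11j², which is the Seifert genus of the Berge sporadic knot k_IX(j). -/
open MeasureTheory Set ENNReal

/-- The non-recursive form of the corners `(a_i^{(j)}, b_i^{(j)})`. -/
theorem ab_eq (j : ℕ) (hj : 1 ≤ j) (i : ℕ) (hi : 1 ≤ i) (hij : i ≤ j + 1) :
    ab j i = (if 2 * i < j + 2 then 2 * (i : ℤ) - 1 else 2 * i - 2,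
      if 2 * i ≤ j + 3 then 2 * (j : ℤ) + 3 - 2 * i else 2 * j + 4 - 2 * i) := by
  induction j, hj using Nat.le_induction generalizing i with
  | base =>
    obtain rfl | rfl : i = 1 ∨ i = 2 := by omega
    · simp [ab]
    · simp [ab]
  | succ j hj ih =>
    obtain ⟨k, rfl⟩ : ∃ k, j = k + 1 := ⟨j - 1, by omega⟩
    rw [ab]
    by_cases h1 : i = 1
    · subst h1
      ext <;> dsimp only <;> split_ifs <;> push_cast <;> omega
    · rw [if_neg h1, ih _ (by omega) (by omega)]
      ext <;> dsimp only <;> split_ifs <;> push_cast <;> omega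

theorem ab_one (j : ℕ) (hj : 1 ≤ j) : ab j 1 = (1, 2 * (j : ℤ) + 1) := by
  rw [ab_eq j hj 1 le_rfl (by omega)]
  ext <;> dsimp only <;> split_ifs <;> omega

theorem ab_last_fst (j : ℕ) (hj : 1 ≤ j) : (ab j (j + 1)).1 = 2 * j := by
  rw [ab_eq j hj _ (by omega) le_rfl]
  dsimp only
  split_ifs <;> omega

theorem ab_bounds (j : ℕ) (hj : 1 ≤ j) (i : ℕ) (hi : 1 ≤ i) (hij : i ≤ j + 1) :
    0 < (ab j i).1 ∧ (ab j i).1 ≤ 2 * j ∧ 0 < (ab j i).2 ∧ (ab j i).2 ≤ 2 * j + 1 := by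
  rw [ab_eq j hj i hi hij]
  dsimp only
  split_ifs <;> omega

theorem mem_SIX {j : ℕ} {p : ℝ × ℝ} : p ∈ SIX j ↔
    (∃ i, (1 ≤ i ∧ i ≤ j + 1) ∧
      (0 ≤ p.1 ∧ p.1 ≤ (ab j i).1) ∧ 0 ≤ p.2 ∧ p.2 ≤ (ab j i).2) ∨
    ((0 ≤ p.1 ∧ p.1 ≤ 2 * j) ∧ -(2 * (j : ℝ)) ≤ p.2 ∧ p.2 ≤ 0) ∨
    ((-(4 * (j : ℝ) + 1) ≤ p.1 ∧ p.1 ≤ 0) ∧ -(2 * (j : ℝ)) ≤ p.2 ∧ p.2 ≤ 2 * j + 1) := by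
  simp only [SIX, Rreg, mem_union, mem_iUnion, Finset.mem_Icc, mem_prod, mem_Icc, exists_prop,
    or_assoc]

/-- The interior of `S_IX(j)` is the union of the open boxes with common lower left corner
`(-(4j+1), -2j)` and upper right corners `(a_i, b_i)`. -/
theorem mem_interior_SIX {j : ℕ} (hj : 1 ≤ j) {p : ℝ × ℝ} : p ∈ interior (SIX j) ↔
    -(4 * (j : ℝ) + 1) < p.1 ∧ -(2 * (j : ℝ)) < p.2 ∧
      ∃ i, (1 ≤ i ∧ i ≤ j + 1) ∧ p.1 < (ab j i).1 ∧ p.2 < (ab j i).2 := by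
  have hj' : (1 : ℝ) ≤ j := by exact_mod_cast hj
  constructor
  · intro hp
    obtain ⟨ε, hε, hball⟩ := Metric.isOpen_iff.1 isOpen_interior p hp
    have key : ∀ d : ℝ, |d| < ε → (p.1 + d, p.2 + d) ∈ SIX j := fun d hd =>
      interior_subset (hball (by simpa [Metric.mem_ball, Prod.dist_eq, Real.dist_eq] using hd))
    have hlow := mem_SIX.1 (key (-(ε / 2)) (by rw [abs_neg, abs_of_pos] <;> linarith))
    have hupp := mem_SIX.1 (key (ε / 2) (by rw [abs_of_pos] <;> linarith))
    dsimp only at hlow hupp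
    refine ⟨?_, ?_, ?_⟩
    · rcases hlow with ⟨i, -, h⟩ | h | h <;> linarith [h.1.1]
    · rcases hlow with ⟨i, -, h⟩ | h | h <;> linarith [h.2.1]
    · rcases hupp with ⟨i, hi, h⟩ | h | h
      · exact ⟨i, hi, by linarith [h.1.2], by linarith [h.2.2]⟩
      · refine ⟨j + 1, ⟨by omega, le_rfl⟩, ?_, ?_⟩
        · rw [ab_last_fst j hj]
          push_cast
          linarith [h.1.2]
        · have : (0 : ℝ) < (ab j (j + 1)).2 := by
            exact_mod_cast (ab_bounds j hj (j + 1) (by omega) le_rfl).2.2.1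
          linarith [h.2.2]
      · refine ⟨1, ⟨le_rfl, by omega⟩, ?_⟩
        rw [ab_one j hj]
        push_cast
        exact ⟨by linarith [h.1.2], by linarith [h.2.2]⟩
  · rintro ⟨hx, hy, i, hi, hxi, hyi⟩
    obtain ⟨-, ha, -, hb⟩ := ab_bounds j hj i hi.1 hi.2
    have ha' : ((ab j i).1 : ℝ) ≤ 2 * j := by exact_mod_cast ha
    have hb' : ((ab j i).2 : ℝ) ≤ 2 * j + 1 := by exact_mod_cast hb
    refine mem_interior.2 ⟨Ioo (-(4 * (j : ℝ) + 1)) (ab j i).1 ×ˢ Ioo (-(2 * (j : ℝ))) (ab j i).2,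
      ?_, isOpen_Ioo.prod isOpen_Ioo, ⟨hx, hxi⟩, hy, hyi⟩
    rintro q ⟨⟨h1, h2⟩, h3, h4⟩
    rw [mem_SIX]
    rcases le_total q.1 0 with hq | hq
    · exact Or.inr (Or.inr ⟨⟨h1.le, hq⟩, h3.le, by linarith⟩)
    rcases le_total q.2 0 with hq' | hq'
    · exact Or.inr (Or.inl ⟨⟨hq, by linarith⟩, h3.le, hq'⟩)
    · exact Or.inl ⟨i, hi, ⟨hq, h2.le⟩, hq', h4.le⟩

/-- The largest `t` such that `(x, 2t - x)` lies in the interior of `S_IX(j)`. -/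
def columnTop (j : ℕ) (x : ℤ) : ℤ :=
  if x < 0 then (x + 2 * j) / 2
  else if (x % 2 = 0 ↔ 2 * (x / 2) < j) then j else j - 1

theorem exists_lt_ab_iff {j : ℕ} (hj : 1 ≤ j) (x t : ℤ) :
    (∃ i, (1 ≤ i ∧ i ≤ j + 1) ∧ x < (ab j i).1 ∧ 2 * t - x < (ab j i).2) ↔
      x < 2 * j ∧ t ≤ columnTop j x := by
  constructor
  · rintro ⟨i, ⟨hi, hij⟩, h⟩
    rw [ab_eq j hj i hi hij] at h
    dsimp only at h
    unfold columnTop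
    split_ifs at h ⊢ <;> omega
  · rintro ⟨hx, ht⟩
    rcases lt_or_ge x 0 with h0 | h0
    · refine ⟨1, ⟨le_rfl, by omega⟩, ?_⟩
      rw [ab_one j hj]
      rw [columnTop, if_pos h0] at ht
      dsimp only
      omega
    · rw [columnTop, if_neg h0.not_gt] at ht
      obtain ⟨n, rfl⟩ := Int.eq_ofNat_of_zero_le h0
      by_cases hn : n % 2 = 0 ∧ j ≤ n
      · refine ⟨n / 2 + 2, ⟨by omega, by omega⟩, ?_⟩
        rw [ab_eq j hj _ (by omega) (by omega)]
        dsimp only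
        split_ifs at ht ⊢ <;> omega
      · refine ⟨(n + 1) / 2 + 1, ⟨by omega, by omega⟩, ?_⟩
        rw [ab_eq j hj _ (by omega) (by omega)]
        dsimp only
        split_ifs at ht ⊢ <;> omega

/-- The interior even lattice points `(x, 2t - x)`, indexed by `x + 4j` and `t`. -/
noncomputable def evenIndex (j : ℕ) : Finset (Σ _ : ℕ, ℤ) :=
  (Finset.range (4 * j + 2 * j)).sigma fun n =>
    Finset.Ioc (((n : ℤ) - 4 * j - 2 * j) / 2) (columnTop j ((n : ℤ) - 4 * j))

theorem card_evenIndex (j : ℕ) : (evenIndex j).card = 11 * j ^ 2 := by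
  have hsum : ∀ m ≤ j, ∑ n ∈ Finset.range (4 * j + 2 * m),
      (Finset.Ioc (((n : ℤ) - 4 * j - 2 * j) / 2) (columnTop j ((n : ℤ) - 4 * j))).card + m ^ 2
        = 8 * j ^ 2 + 4 * j * m := by
    intro m hm
    induction m with
    | zero =>
      rw [Finset.sum_congr rfl (g := fun _ => 2 * j)]
      · simp
        ring
      · intro n hn
        rw [mul_zero, add_zero, Finset.mem_range] at hn
        rw [Int.card_Ioc, columnTop, if_pos (by omega)]
        omega
    | succ m ih =>
      have ih := ih (by omega)
      have hpair :
          (Finset.Ioc ((((4 * j + 2 * m : ℕ) : ℤ) - 4 * j - 2 * j) / 2)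
            (columnTop j (((4 * j + 2 * m : ℕ) : ℤ) - 4 * j))).card +
          (Finset.Ioc ((((4 * j + 2 * m + 1 : ℕ) : ℤ) - 4 * j - 2 * j) / 2)
            (columnTop j (((4 * j + 2 * m + 1 : ℕ) : ℤ) - 4 * j))).card + (2 * m + 1) = 4 * j := by
        rw [Int.card_Ioc, Int.card_Ioc]
        unfold columnTop
        split_ifs <;> omega
      rw [show 4 * j + 2 * (m + 1) = 4 * j + 2 * m + 1 + 1 by ring, Finset.sum_range_succ,
        Finset.sum_range_succ]
      linear_combination ih + hpair
  have := hsum j le_rfl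
  rw [evenIndex, Finset.card_sigma]
  linarith

/-- The lattice point with the given index. -/
def evenPoint (j : ℕ) (q : Σ _ : ℕ, ℤ) : ℝ × ℝ :=
  ((((q.1 : ℤ) - 4 * j : ℤ) : ℝ), ((2 * q.2 - ((q.1 : ℤ) - 4 * j) : ℤ) : ℝ))

theorem evenPoint_injective (j : ℕ) : Function.Injective (evenPoint j) := by
  rintro ⟨n, t⟩ ⟨n', t'⟩ h
  simp only [evenPoint, Prod.mk.injEq, Int.cast_inj] at h
  obtain rfl : n = n' := by omega
  obtain rfl : t = t' := by omega
  rfl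

theorem mem_interior_SIX_intCast {j : ℕ} (hj : 1 ≤ j) (x t : ℤ) :
    ((x : ℝ), ((2 * t - x : ℤ) : ℝ)) ∈ interior (SIX j) ↔
      (-(4 * (j : ℤ) + 1) < x ∧ x < 2 * j) ∧ (x - 2 * j) / 2 < t ∧ t ≤ columnTop j x := by
  have h := exists_lt_ab_iff hj x t
  have h1 : -(4 * (j : ℝ) + 1) < x ↔ -(4 * (j : ℤ) + 1) < x := by exact_mod_cast Iff.rfl
  have h2 : -(2 * (j : ℝ)) < ((2 * t - x : ℤ) : ℝ) ↔ -(2 * (j : ℤ)) < 2 * t - x := by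
    exact_mod_cast Iff.rfl
  have h3 : -(2 * (j : ℤ)) < 2 * t - x ↔ (x - 2 * j) / 2 < t := by omega
  rw [mem_interior_SIX hj]
  simp only [Int.cast_lt, h1, h2, h, h3]
  tauto

theorem image_evenIndex {j : ℕ} (hj : 1 ≤ j) :
    {p : ℝ × ℝ | IsEvenLatticePt p ∧ p ∈ interior (SIX j)} = evenPoint j '' evenIndex j := by
  ext p
  simp only [mem_ofPred_eq, mem_image, Finset.mem_coe, evenIndex, Finset.mem_sigma,
    Finset.mem_range, Finset.mem_Ioc]
  constructor
  · rintro ⟨⟨x, y, hx, hy, s, hs⟩, hp⟩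
    obtain rfl : p = ((x : ℝ), ((2 * s - x : ℤ) : ℝ)) :=
      Prod.ext hx (by rw [hy, show y = 2 * s - x by omega])
    obtain ⟨⟨hx1, hx2⟩, ht⟩ := (mem_interior_SIX_intCast hj x s).1 hp
    have hn : (((x + 4 * j).toNat : ℕ) : ℤ) - 4 * j = x := by omega
    refine ⟨⟨(x + 4 * j).toNat, s⟩, ⟨by dsimp only; omega, ?_⟩, ?_⟩
    · dsimp only
      rwa [hn]
    · dsimp only [evenPoint]
      rw [hn]
  · rintro ⟨⟨n, t⟩, ⟨hn, ht⟩, rfl⟩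
    dsimp only at hn ht
    exact ⟨⟨_, _, rfl, rfl, t, by dsimp only; ring⟩,
      (mem_interior_SIX_intCast hj _ t).2 ⟨⟨by dsimp only; omega, by dsimp only; omega⟩, ht⟩⟩

/-- For every integer `j ≥ 1`, the number of even lattice points in the interior of
`S_IX(j)` equals `11j²`, the Seifert genus of the Berge sporadic knot `k_IX(j)`. -/
theorem stmt_7 (j : ℕ) (hj : 1 ≤ j) :
    Set.ncard {p : ℝ × ℝ | IsEvenLatticePt p ∧ p ∈ interior (SIX j)} = 11 * j ^ 2 := by
  rw [image_evenIndex hj, ncard_image_of_injective _ (evenPoint_injective j), ncard_coe_finset,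
    card_evenIndex]
end

section
/- For every integer m ≥ 2, the number of even lattice points lying in the topological interior of the region S_IX(−m) = R₋(m) ∪ ([0,2m] × [−2m,0]) ∪ ([−(4m−1),0] × [−2m, 2m−1]) ⊆ ℝ² equals 11m² − 9m + 2, which is the Seifert genus of the Berge sporadic knot k_IX(−m). -/
open MeasureTheory Set ENNReal

theorem mem_SIXneg_iff {m : ℕ} (hm : 1 ≤ m) (p : ℝ × ℝ) :
    p ∈ SIXneg m ↔ ∃ i : ℕ, 1 ≤ i ∧ i ≤ m ∧ -(4 * (m : ℝ) - 1) ≤ p.1 ∧ p.1 ≤ 2 * i ∧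
      -(2 * (m : ℝ)) ≤ p.2 ∧ p.2 ≤ 2 * (m : ℝ) + 1 - 2 * i := by
  have hm' : (1 : ℝ) ≤ m := by exact_mod_cast hm
  simp only [SIXneg, Rneg, Set.mem_union, Set.mem_iUnion, Set.mem_prod, Set.mem_Icc,
    Finset.mem_Icc, exists_prop]
  constructor
  · rintro ((⟨i, ⟨h1, h2⟩, ⟨h3, h4⟩, h5, h6⟩ | ⟨⟨h3, h4⟩, h5, h6⟩) | ⟨⟨h3, h4⟩, h5, h6⟩)
    · exact ⟨i, h1, h2, by linarith, h4, by linarith, h6⟩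
    · exact ⟨m, hm, le_rfl, by linarith, h4, h5, by linarith⟩
    · exact ⟨1, le_rfl, hm, h3, by push_cast; linarith, h5, by push_cast; linarith⟩
  · rintro ⟨i, h1, h2, h3, h4, h5, h6⟩
    have h1' : (1 : ℝ) ≤ i := by exact_mod_cast h1
    have h2' : (i : ℝ) ≤ m := by exact_mod_cast h2
    rcases le_total p.1 0 with hx | hx
    · exact Or.inr ⟨⟨h3, hx⟩, h5, by linarith⟩
    · rcases le_total p.2 0 with hy | hy
      · exact Or.inl (Or.inr ⟨⟨hx, by linarith⟩, h5, hy⟩)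
      · exact Or.inl (Or.inl ⟨i, ⟨h1, h2⟩, ⟨hx, h4⟩, hy, h6⟩)

theorem mem_interior_SIXneg_iff {m : ℕ} (hm : 1 ≤ m) (p : ℝ × ℝ) :
    p ∈ interior (SIXneg m) ↔ ∃ i : ℕ, 1 ≤ i ∧ i ≤ m ∧ -(4 * (m : ℝ) - 1) < p.1 ∧
      p.1 < 2 * i ∧ -(2 * (m : ℝ)) < p.2 ∧ p.2 < 2 * (m : ℝ) + 1 - 2 * i := by
  constructor
  · intro hp
    obtain ⟨ε, hε, hball⟩ := Metric.mem_nhds_iff.1 (mem_interior_iff_mem_nhds.1 hp)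
    have hshift : ∀ t : ℝ, |t| < ε → (p.1 + t, p.2 + t) ∈ SIXneg m := by
      intro t ht
      apply hball
      simpa [Prod.dist_eq, Real.dist_eq] using ht
    have habs : |ε / 2| < ε := by rw [abs_of_pos (by linarith)]; linarith
    obtain ⟨i, h1, h2, -, h4, -, h6⟩ := (mem_SIXneg_iff hm _).1 (hshift (ε / 2) habs)
    obtain ⟨-, -, -, h3, -, h5, -⟩ :=
      (mem_SIXneg_iff hm _).1 (hshift (-(ε / 2)) (by rwa [abs_neg]))
    dsimp only at h3 h4 h5 h6
    exact ⟨i, h1, h2, by linarith, by linarith, by linarith, by linarith⟩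
  · rintro ⟨i, h1, h2, h3, h4, h5, h6⟩
    refine mem_interior.2 ⟨Set.Ioo (-(4 * (m : ℝ) - 1)) (2 * i) ×ˢ
      Set.Ioo (-(2 * (m : ℝ))) (2 * (m : ℝ) + 1 - 2 * i), ?_, isOpen_Ioo.prod isOpen_Ioo,
      ⟨h3, h4⟩, h5, h6⟩
    rintro q ⟨⟨h3, h4⟩, h5, h6⟩
    exact (mem_SIXneg_iff hm q).2 ⟨i, h1, h2, h3.le, h4.le, h5.le, h6.le⟩

theorem intCast_mem_interior_SIXneg_iff {m : ℕ} (hm : 1 ≤ m) (x y : ℤ) :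
    ((x : ℝ), (y : ℝ)) ∈ interior (SIXneg m) ↔ ∃ i : ℕ, 1 ≤ i ∧ i ≤ m ∧
      -(4 * (m : ℤ) - 1) < x ∧ x < 2 * i ∧ -(2 * (m : ℤ)) < y ∧ y < 2 * (m : ℤ) + 1 - 2 * i := by
  rw [mem_interior_SIXneg_iff hm]
  dsimp only
  exact_mod_cast Iff.rfl

/-- Index set of the even interior lattice points: `a` runs over pairs of adjacent columns and
`b` over rows; each row meets each pair of columns in exactly one even point. -/
def evenPtIndex (m : ℕ) : Finset (Σ _ : ℕ, ℕ) :=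
  (Finset.range (3 * m - 1)).sigma fun a => Finset.range (4 * m - 2 - 2 * (a - (2 * m - 1)))

/-- The even lattice point in row `b` and column pair `a`. -/
def evenPt (m : ℕ) (s : Σ _ : ℕ, ℕ) : ℝ × ℝ :=
  (((2 * ((s.1 : ℤ) - (2 * m - 1)) + ((s.2 : ℤ) - (2 * m - 1)) % 2 : ℤ) : ℝ),
    (((s.2 : ℤ) - (2 * m - 1) : ℤ) : ℝ))

theorem evenPt_injective (m : ℕ) : Function.Injective (evenPt m) := by
  rintro ⟨a, b⟩ ⟨a', b'⟩ h
  simp only [evenPt, Prod.mk.injEq, Int.cast_inj] at h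
  obtain ⟨h1, h2⟩ := h
  obtain rfl : b = b' := by omega
  obtain rfl : a = a' := by omega
  rfl

theorem image_evenPt {m : ℕ} (hm : 1 ≤ m) :
    evenPt m '' (evenPtIndex m : Set (Σ _ : ℕ, ℕ)) =
      {p : ℝ × ℝ | IsEvenLatticePt p ∧ p ∈ interior (SIXneg m)} := by
  ext p
  constructor
  · rintro ⟨⟨a, b⟩, hs, rfl⟩
    simp only [evenPtIndex, Finset.mem_coe, Finset.mem_sigma, Finset.mem_range] at hs
    refine ⟨⟨_, _, rfl, rfl, ?_⟩, (intCast_mem_interior_SIXneg_iff hm _ _).2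
      ⟨a - (2 * m - 1) + 1, ?_⟩⟩
    · rw [Int.even_iff]; dsimp only; omega
    · dsimp only; omega
  · rintro ⟨⟨x, y, hx, hy, hxy⟩, hp⟩
    obtain rfl : p = ((x : ℝ), (y : ℝ)) := Prod.ext hx hy
    obtain ⟨i, hi⟩ := (intCast_mem_interior_SIXneg_iff hm x y).1 hp
    rw [Int.even_iff] at hxy
    refine ⟨⟨(x / 2 + (2 * m - 1)).toNat, (y + (2 * m - 1)).toNat⟩, ?_, ?_⟩
    · simp only [evenPtIndex, Finset.mem_coe, Finset.mem_sigma, Finset.mem_range]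
      omega
    · simp only [evenPt, Prod.mk.injEq, Int.cast_inj]
      omega

theorem card_evenPtIndex {m : ℕ} (hm : 1 ≤ m) :
    (evenPtIndex m).card = 11 * m ^ 2 - 9 * m + 2 := by
  obtain ⟨n, rfl⟩ : ∃ n, m = n + 1 := ⟨m - 1, by omega⟩
  have hsum : ∀ k ≤ n + 1,
      (∑ j ∈ Finset.range k, ((4 * n + 2 - 2 * j : ℕ) : ℤ)) = k * (4 * n + 3 - k) := by
    intro k
    induction k with
    | zero => simp
    | succ k ih =>
      intro hk
      rw [Finset.sum_range_succ, ih (by omega), Nat.cast_sub (by omega)]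
      push_cast
      ring
  have hcard : (evenPtIndex (n + 1)).card =
      (2 * n + 1) * (4 * n + 2) + ∑ j ∈ Finset.range (n + 1), (4 * n + 2 - 2 * j) := by
    simp only [evenPtIndex, Finset.card_sigma, Finset.card_range]
    rw [show 3 * (n + 1) - 1 = (2 * n + 1) + (n + 1) by omega, Finset.sum_range_add]
    congr 1
    · rw [Finset.sum_congr rfl (g := fun _ => 4 * n + 2)]
      · simp
      · intro a ha
        rw [Finset.mem_range] at ha
        omega
    · refine Finset.sum_congr rfl fun a _ => ?_
      omega
  have hle : 9 * (n + 1) ≤ 11 * (n + 1) ^ 2 := by nlinarith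
  zify [hle]
  rw [hcard]
  push_cast
  rw [hsum _ le_rfl]
  push_cast
  ring

/-- For every integer `m ≥ 2`, the number of even lattice points in the interior of
`S_IX(−m)` equals `11m² − 9m + 2`, the Seifert genus of the Berge sporadic knot `k_IX(−m)`. -/
theorem stmt_8 (m : ℕ) (hm : 2 ≤ m) :
    Set.ncard {p : ℝ × ℝ | IsEvenLatticePt p ∧ p ∈ interior (SIXneg m)} =
      11 * m ^ 2 - 9 * m + 2 := by
  have hm1 : 1 ≤ m := by omega
  rw [← image_evenPt hm1, Set.ncard_image_of_injective _ (evenPt_injective m),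
    Set.ncard_coe_finset, card_evenPtIndex hm1]
end

section
/- For every integer m ≥ 2, the number of even lattice points lying in the topological interior of the region R₋(m) ∪ ([0,2m] × [−2m,0]) ⊆ ℝ² equals 3m² − 3m + 1, which is the Seifert genus of the cable knot C(T(2,3); m, 6m−1) of the trefoil. -/
open MeasureTheory Set ENNReal

lemma mem_interior_of_mem_Ioo {m i : ℕ} (hi : 1 ≤ i) (him : i ≤ m) {p : ℝ × ℝ}
    (hp : p ∈ Set.Ioo (0 : ℝ) (2 * i) ×ˢ Set.Ioo (-(2 * (m : ℝ))) (2 * m + 1 - 2 * i)) :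
    p ∈ interior (Rneg m ∪
      Set.Icc (0 : ℝ) (2 * (m : ℝ)) ×ˢ Set.Icc (-(2 * (m : ℝ))) (0 : ℝ)) := by
  refine mem_interior.2 ⟨_, ?_, isOpen_Ioo.prod isOpen_Ioo, hp⟩
  rintro ⟨x, y⟩ ⟨⟨hx0, hx1⟩, hy0, hy1⟩
  dsimp only at hx0 hx1 hy0 hy1
  have him' : (i : ℝ) ≤ m := by exact_mod_cast him
  rcases le_total y 0 with hy | hy
  · exact Or.inr ⟨⟨hx0.le, by dsimp only; linarith⟩, hy0.le, hy⟩
  · refine Or.inl (Set.mem_biUnion (x := i) (Finset.mem_Icc.2 ⟨hi, him⟩) ?_)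
    exact ⟨⟨hx0.le, hx1.le⟩, hy, hy1.le⟩

lemma exists_pos_diagonal_mem_of_mem_interior {S : Set (ℝ × ℝ)} {x y : ℝ}
    (h : (x, y) ∈ interior S) : ∃ t > 0, (x + t, y + t) ∈ S ∧ (x - t, y - t) ∈ S := by
  have hS : S ∈ nhds (x, y) := mem_interior_iff_mem_nhds.1 h
  have h1 : Filter.Tendsto (fun t : ℝ => (x + t, y + t)) (nhds 0) (nhds (x, y)) :=
    Continuous.tendsto' (by fun_prop) _ _ (by simp)
  have h2 : Filter.Tendsto (fun t : ℝ => (x - t, y - t)) (nhds 0) (nhds (x, y)) :=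
    Continuous.tendsto' (by fun_prop) _ _ (by simp)
  obtain ⟨ε, hε, H⟩ := Metric.eventually_nhds_iff.1
    ((h1.eventually_mem hS).and (h2.eventually_mem hS))
  refine ⟨ε / 2, half_pos hε, H ?_⟩
  rw [Real.dist_eq, sub_zero, abs_of_pos (half_pos hε)]
  exact half_lt_self hε

lemma intCast_mem_interior_iff {m : ℕ} {x y : ℤ} (hxy : Even (x + y)) :
    ((x : ℝ), (y : ℝ)) ∈ interior (Rneg m ∪
      Set.Icc (0 : ℝ) (2 * (m : ℝ)) ×ˢ Set.Icc (-(2 * (m : ℝ))) (0 : ℝ)) ↔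
      0 < x ∧ x < 2 * m ∧ -(2 * m) < y ∧ x + y < 2 * m := by
  constructor
  · intro h
    obtain ⟨t, ht, hpos, hneg⟩ := exists_pos_diagonal_mem_of_mem_interior h
    simp only [Rneg, Set.mem_union, Set.mem_iUnion, Set.mem_prod, Set.mem_Icc,
      Finset.mem_Icc, exists_prop] at hpos hneg
    have hlow : (0 : ℝ) < x ∧ -(2 * (m : ℝ)) < y := by
      have hm0 : (0 : ℝ) ≤ m := m.cast_nonneg
      rcases hneg with ⟨i, -, h1, h2⟩ | ⟨h1, h2⟩ <;> constructor <;> linarith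
    have hx : 0 < x := by exact_mod_cast hlow.1
    have hy : -(2 * (m : ℤ)) < y := by exact_mod_cast hlow.2
    rcases hpos with ⟨i, hi, h1, h2⟩ | ⟨h1, h2⟩
    · have hx' : (x : ℝ) < 2 * i := by linarith
      have hy' : (y : ℝ) < 2 * m + 1 - 2 * i := by linarith
      have hx'' : x < 2 * i := by exact_mod_cast hx'
      have hy'' : y < 2 * m + 1 - 2 * i := by exact_mod_cast hy'
      omega
    · have hx' : (x : ℝ) < 2 * m := by linarith
      have hy' : (y : ℝ) < 0 := by linarith
      have hx'' : x < 2 * m := by exact_mod_cast hx'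
      have hy'' : y < 0 := by exact_mod_cast hy'
      omega
  · rintro ⟨hx0, hx1, hy0, hy1⟩
    obtain ⟨i, hi, him, hxi, hyi⟩ :
        ∃ i : ℕ, 1 ≤ i ∧ i ≤ m ∧ x < 2 * i ∧ y < 2 * m + 1 - 2 * i := by
      obtain ⟨k, hk⟩ := hxy
      rcases le_or_gt y 0 with hy | hy
      · exact ⟨m, by omega, le_rfl, hx1, by omega⟩
      · exact ⟨((x + 2) / 2).toNat, by omega, by omega, by omega, by omega⟩
    refine mem_interior_of_mem_Ioo hi him ⟨⟨?_, ?_⟩, ?_, ?_⟩ <;> dsimp only <;> assumption_mod_cast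

/-- Pairs `(x, c)` encoding the even lattice points `(x + 1, 2c - 2n - (x + 1) % 2)` of the
trapezoid `0 < x < 2(n+1)`, `-2(n+1) < y < 2(n+1) - x`. -/
def trapezoidIndex (n : ℕ) : Finset (Σ _ : ℕ, ℕ) :=
  (Finset.range (2 * n + 1)).sigma fun x => Finset.range (2 * n + 1 - (x + 1) / 2)

lemma sum_range_succ_div_two (n : ℕ) :
    ∑ x ∈ Finset.range (2 * n + 1), (x + 1) / 2 = n * (n + 1) := by
  induction n with
  | zero => simp
  | succ n ih =>
    rw [show 2 * (n + 1) + 1 = 2 * n + 1 + 1 + 1 by ring, Finset.sum_range_succ,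
      Finset.sum_range_succ, ih, show (2 * n + 1 + 1) / 2 = n + 1 by omega,
      show (2 * n + 1 + 1 + 1) / 2 = n + 1 by omega]
    ring

lemma card_trapezoidIndex (n : ℕ) : (trapezoidIndex n).card = 3 * n ^ 2 + 3 * n + 1 := by
  have h : (trapezoidIndex n).card + n * (n + 1) = (2 * n + 1) * (2 * n + 1) := by
    rw [trapezoidIndex, Finset.card_sigma, ← sum_range_succ_div_two, ← Finset.sum_add_distrib,
      Finset.sum_congr rfl (g := fun _ => 2 * n + 1)]
    · simp
    · intro x hx
      rw [Finset.mem_range] at hx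
      rw [Finset.card_range]
      omega
  nlinarith

/-- The even lattice point encoded by an element of `trapezoidIndex n`. -/
def trapezoidPoint (n : ℕ) (a : Σ _ : ℕ, ℕ) : ℝ × ℝ :=
  (((a.1 + 1 : ℤ) : ℝ), ((2 * a.2 - 2 * n - (a.1 + 1) % 2 : ℤ) : ℝ))

lemma trapezoidPoint_injective (n : ℕ) : Function.Injective (trapezoidPoint n) := by
  rintro ⟨x, c⟩ ⟨x', c'⟩ h
  simp only [trapezoidPoint, Prod.mk.injEq, Int.cast_inj] at h
  obtain rfl : x = x' := by omega
  obtain rfl : c = c' := by omega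
  rfl

/-- For every integer `m ≥ 2`, the number of even lattice points in the interior of the
region `R₋(m) ∪ ([0,2m] × [−2m,0])` of the intermediate curve `P_m(−m)` equals
`3m² − 3m + 1`, the Seifert genus of the cable knot `C(T(2,3); m, 6m−1)` of the trefoil. -/
theorem stmt_16 (m : ℕ) (hm : 2 ≤ m) :
    Set.ncard {p : ℝ × ℝ | IsEvenLatticePt p ∧
        p ∈ interior (Rneg m ∪
          Set.Icc (0 : ℝ) (2 * (m : ℝ)) ×ˢ Set.Icc (-(2 * (m : ℝ))) (0 : ℝ))} =
      3 * m ^ 2 - 3 * m + 1 := by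
  obtain ⟨n, rfl⟩ : ∃ n, m = n + 1 := ⟨m - 1, by omega⟩
  have key : {p : ℝ × ℝ | IsEvenLatticePt p ∧ p ∈ interior (Rneg (n + 1) ∪
      Set.Icc (0 : ℝ) (2 * ((n + 1 : ℕ) : ℝ)) ×ˢ Set.Icc (-(2 * ((n + 1 : ℕ) : ℝ))) (0 : ℝ))} =
      trapezoidPoint n '' (trapezoidIndex n : Set (Σ _ : ℕ, ℕ)) := by
    ext ⟨p, q⟩
    constructor
    · rintro ⟨⟨x, y, rfl, rfl, hxy⟩, h⟩
      rw [intCast_mem_interior_iff hxy] at h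
      obtain ⟨k, hk⟩ := hxy
      refine ⟨⟨(x - 1).toNat, ((y + 2 * n + x % 2) / 2).toNat⟩, ?_, ?_⟩
      · simp only [trapezoidIndex, Finset.mem_coe, Finset.mem_sigma, Finset.mem_range]
        omega
      · simp only [trapezoidPoint, Prod.mk.injEq, Int.cast_inj]
        omega
    · rintro ⟨⟨x, c⟩, hmem, h⟩
      simp only [trapezoidIndex, Finset.mem_coe, Finset.mem_sigma, Finset.mem_range] at hmem
      rw [← h]
      have heven : Even ((x + 1 : ℤ) + (2 * c - 2 * n - (x + 1) % 2)) := by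
        rw [Int.even_iff]
        omega
      refine ⟨⟨_, _, rfl, rfl, heven⟩, (intCast_mem_interior_iff heven).2 ?_⟩
      omega
  rw [key, Set.ncard_image_of_injective _ (trapezoidPoint_injective n), Set.ncard_coe_finset,
    card_trapezoidIndex]
  have h : 3 * (n + 1) ^ 2 = 3 * n ^ 2 + 3 * n + 3 * (n + 1) := by ring
  rw [h, Nat.add_sub_cancel]
end

section
/- For every integer j ≥ 1, the recursively defined sequence (a_i^{(j)}, b_i^{(j)})_{i=1}^{j+1} satisfies: 0 < a_1^{(j)} < a_2^{(j)} < … < a_{j+1}^{(j)} and b_1^{(j)} > b_2^{(j)} > … > b_{j+1}^{(j)} > 0; moreover a_1^{(j)} = 1, b_1^{(j)} = 2j+1, a_{j+1}^{(j)} = 2j, and for every 1 ≤ i ≤ j the concave point (a_i^{(j)}, b_{i+1}^{(j)}) is an even lattice point, i.e. a_i^{(j)} + b_{i+1}^{(j)} is even. -/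
open MeasureTheory Set ENNReal

theorem ab_one_right (n : ℕ) : ab (n + 2) 1 = (1, 2 * ((n : ℤ) + 2) + 1) := by
  simp [ab]

theorem ab_add_two_right (n i : ℕ) :
    ab (n + 2) (i + 2) =
      ((ab (n + 1) (n + 2 - i)).2 + 1, (ab (n + 1) (n + 2 - i)).1 + 1) := by
  have h : n + 2 + 2 - (i + 2) = n + 2 - i := by omega
  simp [ab, h]

/-- For every `j ≥ 1`, the recursively defined sequence `(a_i^{(j)}, b_i^{(j)})_{i=1}^{j+1}`
satisfies `0 < a_1 < ⋯ < a_{j+1}`, `b_1 > ⋯ > b_{j+1} > 0`, `a_1 = 1`, `b_1 = 2j+1`,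
`a_{j+1} = 2j`, and each concave point `(a_i, b_{i+1})`, `1 ≤ i ≤ j`, is an even lattice
point, i.e. `a_i + b_{i+1}` is even. -/
theorem stmt_19 (j : ℕ) (hj : 1 ≤ j) :
    (0 < (ab j 1).1) ∧
    (∀ i : ℕ, 1 ≤ i → i ≤ j → (ab j i).1 < (ab j (i + 1)).1) ∧
    (∀ i : ℕ, 1 ≤ i → i ≤ j → (ab j (i + 1)).2 < (ab j i).2) ∧
    (0 < (ab j (j + 1)).2) ∧
    (ab j 1).1 = 1 ∧
    (ab j 1).2 = 2 * (j : ℤ) + 1 ∧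
    (ab j (j + 1)).1 = 2 * (j : ℤ) ∧
    (∀ i : ℕ, 1 ≤ i → i ≤ j → Even ((ab j i).1 + (ab j (i + 1)).2)) := by
  induction j, hj using Nat.le_induction with
  | base =>
    refine ⟨by simp [ab], ?_, ?_, by simp [ab], by simp [ab], by simp [ab], by simp [ab], ?_⟩ <;>
    · intro i hi hi'
      obtain rfl : i = 1 := by omega
      simp [ab]
  | succ j hj ih =>
    obtain ⟨n, rfl⟩ : ∃ n, j = n + 1 := ⟨j - 1, by omega⟩
    obtain ⟨-, hmono, hanti, hpos, ha, hb, hlast, heven⟩ := ih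
    have hsecond := ab_add_two_right n 0
    have hend := ab_add_two_right n (n + 1)
    rw [show n + 2 - (n + 1) = 1 by omega] at hend
    have hshift (i : ℕ) (hi : 1 ≤ i) (hi' : i ≤ n + 1 + 1) (hne : i ≠ 1) :
        ∃ k, 1 ≤ k ∧ k ≤ n + 1 ∧
          ab (n + 2) i = ((ab (n + 1) (k + 1)).2 + 1, (ab (n + 1) (k + 1)).1 + 1) ∧
          ab (n + 2) (i + 1) = ((ab (n + 1) k).2 + 1, (ab (n + 1) k).1 + 1) := by
      obtain ⟨m, rfl⟩ : ∃ m, i = m + 2 := ⟨i - 2, by omega⟩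
      refine ⟨n + 1 - m, by omega, by omega, ?_, ?_⟩
      · rw [ab_add_two_right, show n + 2 - m = n + 1 - m + 1 by omega]
      · rw [show m + 2 + 1 = (m + 1) + 2 by omega, ab_add_two_right,
          show n + 2 - (m + 1) = n + 1 - m by omega]
    push_cast at hb hlast ⊢
    refine ⟨by simp [ab_one_right], ?_, ?_, ?_, by simp [ab_one_right], ?_, ?_, ?_⟩
    · intro i hi hi'
      by_cases h : i = 1
      · subst h
        rw [ab_one_right, hsecond]
        simpa using hpos
      · obtain ⟨k, hk, hk', e, e'⟩ := hshift i hi hi' h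
        rw [e, e']
        simpa using hanti k hk hk'
    · intro i hi hi'
      by_cases h : i = 1
      · subst h
        rw [ab_one_right, hsecond]
        simp only [Nat.sub_zero]
        linarith
      · obtain ⟨k, hk, hk', e, e'⟩ := hshift i hi hi' h
        rw [e, e']
        simpa using hmono k hk hk'
    · rw [hend]
      simp [ha]
    · rw [ab_one_right]
      ring
    · rw [hend]
      linarith
    · intro i hi hi'
      by_cases h : i = 1
      · subst h
        rw [ab_one_right, hsecond]
        simp only [Nat.sub_zero]
        exact ⟨n + 2, by linarith⟩
      · obtain ⟨k, hk, hk', e, e'⟩ := hshift i hi hi' h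
        obtain ⟨r, hr⟩ := heven k hk hk'
        rw [e, e']
        exact ⟨r + 1, by linarith⟩
end
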